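/- arXiv:2406.17486 — 3 statements merged into one kernel-verified Lean document; each statement's English description precedes it below -/
import Mathlib

section
/- For every K ∈ ℕ and every constant c > 1/2 there exist β > 0 and D₀ such that the following holds. Let G ∈ H(K) be a finite graph with δ(G) ≥ D₀, let x ∈ V(G), let p := 1/2 − c·√(log d(x)/d(x)), let A₀ be a p-random subset of V(G), and let (Â_ℓ) be the Boot₂(γ) process started from A₀. Then Pr[x ∈ Â₃ \ Â₂] ≤ exp(−β·γ(x)²·log d(x)). -/
open SimpleGraph Filter

namespace MBP

/-- Degree of a vertex, via the cardinality of its neighbourhood. -/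
noncomputable def deg {V : Type} (G : SimpleGraph V) (x : V) : ℕ :=
  (G.neighborSet x).ncard

/-- Minimum degree. -/
noncomputable def minDeg {V : Type} (G : SimpleGraph V) : ℕ :=
  sInf (Set.range (deg G))

/-- Maximum degree. -/
noncomputable def maxDeg {V : Type} (G : SimpleGraph V) : ℕ :=
  sSup (Set.range (deg G))

/-- Ball of radius `ℓ` around `x`. -/
def ball {V : Type} (G : SimpleGraph V) (x : V) (ℓ : ℕ) : Set V :=
  {y | G.edist x y ≤ ℓ}

/-- Sphere of radius `ℓ` around `x` (for `ℓ ≥ 1` this is `B(x,ℓ) \ B(x,ℓ-1)`). -/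
def sphere {V : Type} (G : SimpleGraph V) (x : V) (ℓ : ℕ) : Set V :=
  {y | G.edist x y = ℓ}

/-- (P1) locally K-almost regular. -/
def P1 (K : ℕ) {V : Type} (G : SimpleGraph V) : Prop :=
  ∀ (x : V) (ℓ : ℕ), 1 ≤ ℓ → ∀ y ∈ sphere G x ℓ,
    |(deg G x : ℤ) - (deg G y : ℤ)| ≤ (K : ℤ) * ℓ

/-- (P2) K-bounded backwards expansion. -/
def P2 (K : ℕ) {V : Type} (G : SimpleGraph V) : Prop :=
  ∀ (x : V) (ℓ : ℕ), 1 ≤ ℓ → ∀ y ∈ sphere G x ℓ,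
    (G.neighborSet y ∩ ball G x ℓ).ncard ≤ K * ℓ

/-- `D` witnesses property (P3) (typical local structure and K-separation) at vertex `x`. -/
def P3At (K : ℕ) {V : Type} (G : SimpleGraph V) (x : V) (D : Set V) : Prop :=
  x ∉ D ∧ ∀ (ℓ : ℕ), 1 ≤ ℓ →
    ((D ∩ sphere G x ℓ).ncard ≤ K ^ (ℓ - 1) * (deg G x) ^ (ℓ - 1)) ∧
    (∀ y ∈ sphere G x ℓ \ D, (D ∩ G.neighborSet y).ncard ≤ K * ℓ) ∧
    (∀ y ∈ sphere G x ℓ \ D, ∀ z ∈ sphere G x ℓ \ D, y ≠ z →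
      (G.neighborSet y ∩ G.neighborSet z ∩ (sphere G x (ℓ + 1) \ D)).ncard ≤ 1) ∧
    (∀ y ∈ sphere G x ℓ \ D,
      (ball G y (2 * ℓ - 1) ∩ (sphere G x ℓ \ D)).ncard ≤ ℓ * K ^ (ℓ - 1) * (deg G x) ^ (ℓ - 1))

/-- (P3) typical local structure and K-separation. -/
def P3 (K : ℕ) {V : Type} (G : SimpleGraph V) : Prop :=
  ∀ x : V, ∃ D : Set V, P3At K G x D

/-- (P5) exponential order. -/
def P5 (K : ℕ) {V : Type} (G : SimpleGraph V) : Prop :=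
  (Nat.card V : ℝ) ≤ Real.exp (K * minDeg G)

/-- (P4) K-projection, relative to a membership predicate `mem` for the projected subgraphs. -/
def P4With (K : ℕ) {V : Type} (G : SimpleGraph V) (mem : G.Subgraph → Prop) : Prop :=
  ∀ (x : V) (ℓ : ℕ), 1 ≤ ℓ → ∀ y ∈ sphere G x ℓ,
    ∃ H : G.Subgraph, y ∈ H.verts ∧ mem H ∧
      H.verts ∩ ball G x (ℓ - 1) = ∅ ∧
      ∀ w : H.verts, |(deg H.coe w : ℤ) - (deg G (w : V) : ℤ)| ≤ (K : ℤ) * ℓ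

/-- Membership in the class H(K) with recursion fuel `n`. -/
def HAux (K : ℕ) : ℕ → (V : Type) → SimpleGraph V → Prop
  | 0, V, _ => Nat.card V = 1
  | n + 1, V, G =>
      Nat.card V = 1 ∨
        (P1 K G ∧ P2 K G ∧ P3 K G ∧ P4With K G (fun H => HAux K n H.verts H.coe) ∧ P5 K G)

/-- The class `H(K)` of geometric graphs: least class containing the one-vertex graph and
closed under properties (P1)–(P5), where the projections of (P4) again lie in the class. -/
def InH (K : ℕ) {V : Type} (G : SimpleGraph V) : Prop :=
  ∃ n, HAux K n V G

/-- One round of majority bootstrap percolation: a vertex `v` becomes infected if at least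
`d(v)/2` of its neighbours are infected. -/
def bootStep {V : Type} (G : SimpleGraph V) (A : Set V) : Set V :=
  A ∪ {v | (deg G v : ℝ) / 2 ≤ ((G.neighborSet v ∩ A).ncard : ℝ)}

/-- The majority bootstrap percolation process. -/
def bootIter {V : Type} (G : SimpleGraph V) (A0 : Set V) : ℕ → Set V
  | 0 => A0
  | n + 1 => bootStep G (bootIter G A0 n)

/-- `A0` percolates if eventually every vertex is infected. -/
def Percolates {V : Type} (G : SimpleGraph V) (A0 : Set V) : Prop :=
  (⋃ i, bootIter G A0 i) = Set.univ

/-- Weight of a subset `A` under the `p`-random measure. -/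
noncomputable def weight {V : Type} (p : ℝ) (A : Set V) : ℝ :=
  p ^ A.ncard * (1 - p) ^ (Aᶜ).ncard

/-- Probability that a `p`-random subset of `V` satisfies the event `E`. -/
noncomputable def prob {V : Type} (p : ℝ) (E : Set V → Prop) : ℝ :=
  ∑ᶠ A ∈ {A : Set V | E A}, weight p A

/-- Probability that a `p`-random initial set percolates. -/
noncomputable def Phi {V : Type} (p : ℝ) (G : SimpleGraph V) : ℝ :=
  prob p (fun A0 => Percolates G A0)

/-- One round of the `m`-shifted bootstrap process (threshold `d(v)/2 + m`). -/
def bootStepM {V : Type} (G : SimpleGraph V) (m : ℕ) (A : Set V) : Set V :=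
  A ∪ {v | (deg G v : ℝ) / 2 + m ≤ ((G.neighborSet v ∩ A).ncard : ℝ)}

/-- The `m`-shifted bootstrap process. -/
def bootIterM {V : Type} (G : SimpleGraph V) (m : ℕ) (A0 : Set V) : ℕ → Set V
  | 0 => A0
  | n + 1 => bootStepM G m (bootIterM G m A0 n)

/-- `σ(x) = √(log d(x) / d(x))`. -/
noncomputable def sigma' {V : Type} (G : SimpleGraph V) (x : V) : ℝ :=
  Real.sqrt (Real.log (deg G x) / (deg G x))

/-- `γ(x) = √(d(x) / √(log d(x)))`. -/
noncomputable def gamma' {V : Type} (G : SimpleGraph V) (x : V) : ℝ :=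
  Real.sqrt ((deg G x : ℝ) / Real.sqrt (Real.log (deg G x)))

/-- The `Boot₂(γ)` process: in the step from round `ℓ` to round `ℓ+1`, a vertex `v` becomes
infected if at least `d(v)/2 - max(0, 2-ℓ)·γ(v)` of its neighbours are infected. -/
noncomputable def hatIter {V : Type} (G : SimpleGraph V) (A0 : Set V) : ℕ → Set V
  | 0 => A0
  | ℓ + 1 =>
      hatIter G A0 ℓ ∪
        {v | (deg G v : ℝ) / 2 - ((2 - ℓ : ℕ) : ℝ) * gamma' G v
              ≤ ((G.neighborSet v ∩ hatIter G A0 ℓ).ncard : ℝ)}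

/-- Expectation of `f` restricted to the event `E`, under the `p`-random measure. -/
noncomputable def expOn {V : Type} (p : ℝ) (E : Set V → Prop) (f : Set V → ℝ) : ℝ :=
  ∑ᶠ A ∈ {A : Set V | E A}, weight p A * f A

/-- Conditional expectation of `f` given the event `E`. -/
noncomputable def condExp {V : Type} (p : ℝ) (E : Set V → Prop) (f : Set V → ℝ) : ℝ :=
  expOn p E f / prob p E

/-- Conditional variance of `f` given the event `E`. -/
noncomputable def condVar {V : Type} (p : ℝ) (E : Set V → Prop) (f : Set V → ℝ) : ℝ :=
  condExp p E (fun A => (f A - condExp p E f) ^ 2)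

/-- The number of edges between `U` and `W` (ordered pairs `(u,w)` with `u ∈ U`, `w ∈ W`
adjacent; for disjoint sets this is the number of edges with one endpoint in each). -/
noncomputable def eBetween {V : Type} (G : SimpleGraph V) (U W : Set V) : ℕ :=
  {e : V × V | e.1 ∈ U ∧ e.2 ∈ W ∧ G.Adj e.1 e.2}.ncard

/-- Upper tail `Pr[Bin(d,p) ≥ t]` of the binomial distribution. -/
noncomputable def binTail (d : ℕ) (p : ℝ) (t : ℝ) : ℝ :=
  ∑ k ∈ Finset.range (d + 1),
    if t ≤ (k : ℝ) then (d.choose k : ℝ) * p ^ k * (1 - p) ^ (d - k) else 0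

lemma bern_mgf (p s : ℝ) (h0 : 0 ≤ p) (h1 : p ≤ 1) :
    1 - p + p * Real.exp s ≤ Real.exp (p * s + s ^ 2 / 8) := by
  let μ : MeasureTheory.Measure Bool :=
    ENNReal.ofReal p • MeasureTheory.Measure.dirac true +
      ENNReal.ofReal (1 - p) • MeasureTheory.Measure.dirac false
  have hμ : MeasureTheory.IsProbabilityMeasure μ := by
    constructor
    simp only [μ, MeasureTheory.Measure.add_apply, MeasureTheory.Measure.smul_apply,
      MeasureTheory.measure_univ, smul_eq_mul, mul_one]
    rw [← ENNReal.ofReal_add h0 (by linarith)]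
    simp
  have hint : ∀ f : Bool → ℝ, ∫ b, f b ∂μ = p * f true + (1 - p) * f false := by
    intro f
    rw [MeasureTheory.integral_add_measure ((MeasureTheory.integrable_dirac (by simp)).smul_measure ENNReal.ofReal_ne_top)
      ((MeasureTheory.integrable_dirac (by simp)).smul_measure ENNReal.ofReal_ne_top)]
    simp [MeasureTheory.integral_smul_measure, ENNReal.toReal_ofReal h0,
      ENNReal.toReal_ofReal (sub_nonneg.2 h1)]
  let X : Bool → ℝ := fun b => if b then 1 else 0
  have key := ProbabilityTheory.hasSubgaussianMGF_of_mem_Icc (μ := μ) (X := X) (a := 0) (b := 1)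
    (by fun_prop) (by
      refine Filter.Eventually.of_forall fun b => ?_
      cases b <;> simp [X])
  have := key.mgf_le s
  simp only [ProbabilityTheory.mgf, hint, X] at this
  norm_num at this
  have e : 1 - p + p * Real.exp s =
      (p * Real.exp (s * (1 - p)) + (1 - p) * Real.exp (-(s * p))) * Real.exp (p * s) := by
    rw [add_mul, mul_assoc, mul_assoc, ← Real.exp_add, ← Real.exp_add]
    ring_nf
    simp
    ring
  rw [e]
  calc _ ≤ _ := mul_le_mul_of_nonneg_right this (Real.exp_pos _).le
    _ = _ := by rw [← Real.exp_add]; ring_nf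

section Prob

lemma weight_nonneg {V : Type} {p : ℝ} (h0 : 0 ≤ p) (h1 : p ≤ 1) (A : Set V) : 0 ≤ weight p A :=
  mul_nonneg (pow_nonneg h0 _) (pow_nonneg (by linarith) _)

open Classical in
lemma prob_eq {V : Type} [Fintype V] (p : ℝ) (E : Set V → Prop) :
    prob p E = ∑ A : Finset V, if E A then weight p (A : Set V) else 0 := by
  unfold prob
  rw [finsum_mem_eq_finite_toFinset_sum _ (Set.toFinite _), ← Finset.sum_filter]
  symm
  refine Finset.sum_bij (fun A _ => (A : Set V)) ?_ ?_ ?_ ?_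
  · intro A hA; simpa using hA
  · intro A _ B _ h; exact_mod_cast h
  · intro A hA
    refine ⟨A.toFinset, ?_, by simp⟩
    simpa using hA
  · intros; rfl

lemma prob_le_sum {V : Type} [Finite V] {ι : Type} (p : ℝ) (h0 : 0 ≤ p) (h1 : p ≤ 1) (I : Finset ι)
    (E : Set V → Prop) (F : ι → Set V → Prop) (h : ∀ A, E A → ∃ i ∈ I, F i A) :
    prob p E ≤ ∑ i ∈ I, prob p (F i) := by
  classical
  have := Fintype.ofFinite V
  simp only [prob_eq]
  rw [Finset.sum_comm]
  refine Finset.sum_le_sum fun A _ => ?_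
  have hn : ∀ i ∈ I, 0 ≤ if F i A then weight p (A : Set V) else 0 := by
    intro i _; split_ifs
    · exact weight_nonneg h0 h1 _
    · exact le_rfl
  split_ifs with hE
  · obtain ⟨i, hi, hF⟩ := h _ hE
    calc weight p (A : Set V) = if F i A then weight p (A : Set V) else 0 := by rw [if_pos hF]
      _ ≤ _ := Finset.single_le_sum hn hi
  · exact Finset.sum_nonneg hn

lemma prob_hoeffding {V : Type} [Fintype V] (p : ℝ) (h0 : 0 ≤ p) (h1 : p ≤ 1) (E : Set V → Prop) (m : V → ℝ)
    (a l : ℝ) (hl : 0 ≤ l)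
    (h : ∀ A : Finset V, E A → a + p * ∑ w, m w ≤ ∑ w ∈ A, m w) :
    prob p E ≤ Real.exp (-(l * a) + l ^ 2 / 8 * ∑ w, m w ^ 2) := by
  classical
  rw [prob_eq]
  have step : ∀ A : Finset V, (if E A then weight p (A : Set V) else 0) ≤
      Real.exp (-(l * (a + p * ∑ w, m w))) *
        ((∏ w ∈ A, (p * Real.exp (l * m w))) * ∏ w ∈ Finset.univ \ A, (1 - p)) := by
    intro A
    have hw : weight p (A : Set V) = (∏ w ∈ A, p) * ∏ w ∈ Finset.univ \ A, (1 - p) := by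
      unfold weight
      rw [← Finset.coe_compl, Set.ncard_coe_finset, Set.ncard_coe_finset, Finset.prod_const,
        Finset.prod_const, Finset.compl_eq_univ_sdiff]
    have e : Real.exp (-(l * (a + p * ∑ w, m w))) *
        ((∏ w ∈ A, (p * Real.exp (l * m w))) * ∏ w ∈ Finset.univ \ A, (1 - p)) =
        weight p (A : Set V) * Real.exp (l * (∑ w ∈ A, m w - (a + p * ∑ w, m w))) := by
      rw [hw, Finset.prod_mul_distrib, ← Real.exp_sum, ← Finset.mul_sum, mul_sub l (∑ w ∈ A, m w),
        Real.exp_sub, Real.exp_neg]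
      ring
    rw [e]
    have hwn := weight_nonneg h0 h1 (A : Set V)
    split_ifs with hE
    · refine le_mul_of_one_le_right hwn (Real.one_le_exp ?_)
      exact mul_nonneg hl (sub_nonneg.2 (h A hE))
    · exact mul_nonneg hwn (Real.exp_pos _).le
  calc _ ≤ _ := Finset.sum_le_sum fun A _ => step A
    _ = Real.exp (-(l * (a + p * ∑ w, m w))) * ∏ w : V, (p * Real.exp (l * m w) + (1 - p)) := by
      rw [← Finset.mul_sum, Finset.prod_add, Finset.powerset_univ]
    _ ≤ Real.exp (-(l * (a + p * ∑ w, m w))) *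
        ∏ w : V, Real.exp (p * (l * m w) + (l * m w) ^ 2 / 8) := by
      refine mul_le_mul_of_nonneg_left ?_ (Real.exp_pos _).le
      refine Finset.prod_le_prod (fun w _ => ?_) (fun w _ => ?_)
      · have := mul_nonneg h0 (Real.exp_pos (l * m w)).le
        linarith
      · have := bern_mgf p (l * m w) h0 h1
        linarith
    _ = _ := by
      rw [← Real.exp_sum, ← Real.exp_add, Finset.sum_add_distrib]
      congr 1
      simp only [Finset.mul_sum, mul_add, mul_pow]
      rw [neg_add, add_assoc]
      congr 1
      rw [← add_assoc]
      have : ∑ i, l * (p * m i) = ∑ i, p * (l * m i) :=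
        Finset.sum_congr rfl fun _ _ => by ring
      rw [this]
      simp only [neg_add_cancel, zero_add]
      exact Finset.sum_congr rfl fun _ _ => by ring

end Prob

lemma second_moment {V : Type} [Fintype V] [DecidableEq V] (N : V → Finset V)
    (P : Finset (V × V)) (Y : Finset V) (B k : ℕ)
    (hY : Y.card = k) (hPY : ∀ q ∈ P, q.1 ∈ Y) (hB : ∀ q ∈ P, (N q.2).card ≤ B)
    (hN : ∀ q ∈ P, ∀ q' ∈ P, q.2 ≠ q'.2 → (N q.2 ∩ N q'.2).card ≤ 1)
    (hC : ∀ y z w w', (y, w) ∈ P → (z, w) ∈ P → (y, w') ∈ P → (z, w') ∈ P → y ≠ z → w = w') :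
    ∑ w, (P.filter (fun q => w ∈ N q.2)).card ^ 2 ≤ P.card * B + k ^ 2 * B + P.card ^ 2 := by
  have e1 : ∑ w, (P.filter (fun q => w ∈ N q.2)).card ^ 2 =
      ∑ r ∈ P ×ˢ P, (N r.1.2 ∩ N r.2.2).card := by
    have : ∀ w, (P.filter (fun q => w ∈ N q.2)).card ^ 2 =
        ∑ r ∈ P ×ˢ P, if w ∈ N r.1.2 ∩ N r.2.2 then 1 else 0 := by
      intro w
      rw [sq, ← Finset.card_product, ← Finset.filter_product, Finset.card_filter]
      simp
    simp only [this]
    rw [Finset.sum_comm]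
    refine Finset.sum_congr rfl fun r _ => ?_
    rw [← Finset.card_filter]
    congr 1
    ext; simp
  rw [e1]
  have e2 : ((P ×ˢ P).filter (fun r => r.1.2 = r.2.2)).card ≤ P.card + k ^ 2 := by
    rw [← Finset.card_filter_add_card_filter_not (p := fun r : (V × V) × V × V => r.1.1 = r.2.1)]
    refine add_le_add ?_ ?_
    · refine Finset.card_le_card_of_injOn (fun r => r.1) ?_ ?_
      · intro r hr
        simp at hr
        exact hr.1.1.1
      · rintro ⟨⟨a, b⟩, ⟨a', b'⟩⟩ hr ⟨⟨c, d⟩, ⟨c', d'⟩⟩ hr'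
        simp at hr hr' ⊢
        grind
    · rw [← hY, sq, ← Finset.card_product]
      refine Finset.card_le_card_of_injOn (fun r => (r.1.1, r.2.1)) ?_ ?_
      · intro r hr
        simp at hr ⊢
        exact ⟨hPY _ hr.1.1.1, hPY _ hr.1.1.2⟩
      · rintro ⟨⟨a, b⟩, ⟨a', b'⟩⟩ hr ⟨⟨c, d⟩, ⟨c', d'⟩⟩ hr'
        simp at hr hr' ⊢
        grind
  calc ∑ r ∈ P ×ˢ P, (N r.1.2 ∩ N r.2.2).card
      ≤ ∑ r ∈ P ×ˢ P, (1 + if r.1.2 = r.2.2 then B else 0) := by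
        refine Finset.sum_le_sum fun r hr => ?_
        rw [Finset.mem_product] at hr
        split_ifs with h
        · have := hB _ hr.1
          rw [← h, Finset.inter_self]; omega
        · exact hN _ hr.1 _ hr.2 h
    _ = P.card ^ 2 + ((P ×ˢ P).filter (fun r => r.1.2 = r.2.2)).card * B := by
        rw [Finset.sum_add_distrib, ← Finset.sum_filter]
        simp [sq]
    _ ≤ _ := by nlinarith [Nat.mul_le_mul_right B e2]

/-- The function `γ` in terms of the degree. -/
noncomputable def gam (d : ℕ) : ℝ := Real.sqrt ((d : ℝ) / Real.sqrt (Real.log d))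

lemma gamma'_eq {V : Type} (G : SimpleGraph V) (x : V) : gamma' G x = gam (deg G x) := rfl

lemma adj_sphere {V : Type} {G : SimpleGraph V} {x y z : V} {ℓ : ℕ} (hy : y ∈ sphere G x ℓ)
    (h : G.Adj y z) : z ∈ ball G x ℓ ∨ z ∈ sphere G x (ℓ + 1) := by
  have h1 : G.edist x z ≤ G.edist x y + G.edist y z := SimpleGraph.edist_triangle
  rw [SimpleGraph.edist_eq_one_iff_adj.2 h, show G.edist x y = ℓ from hy] at h1
  unfold ball sphere
  simp only [Set.mem_ofPred_eq]
  rcases lt_or_eq_of_le h1 with h2 | h2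
  · left
    exact Order.lt_add_one_iff_of_not_isMax (by simp) |>.1 h2
  · right; rw [h2]; simp

lemma forward_count {K : ℕ} {V : Type} [Finite V] {G : SimpleGraph V} {x y : V} {ℓ : ℕ}
    {D : Set V} (hℓ : 1 ≤ ℓ) (h2 : P2 K G) (h3 : P3At K G x D) (hy : y ∈ sphere G x ℓ \ D)
    (U : Set V) :
    (G.neighborSet y ∩ U).ncard ≤
      (G.neighborSet y ∩ U ∩ (sphere G x (ℓ + 1) \ D)).ncard + 2 * K * ℓ := by
  have a := h2 x ℓ hℓ y hy.1
  have b := (h3.2 ℓ hℓ).2.1 y hy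
  have hsub : G.neighborSet y ∩ U ⊆ (G.neighborSet y ∩ U ∩ (sphere G x (ℓ + 1) \ D)) ∪
      ((G.neighborSet y ∩ ball G x ℓ) ∪ (D ∩ G.neighborSet y)) := by
    intro z hz
    have := adj_sphere hy.1 hz.1
    by_cases hzD : z ∈ D
    · right; right; exact ⟨hzD, hz.1⟩
    · rcases this with h | h
      · right; left; exact ⟨hz.1, h⟩
      · left; exact ⟨hz, h, hzD⟩
  have c := Set.ncard_le_ncard hsub (Set.toFinite _)
  have d := Set.ncard_union_le (G.neighborSet y ∩ U ∩ (sphere G x (ℓ + 1) \ D))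
      ((G.neighborSet y ∩ ball G x ℓ) ∪ (D ∩ G.neighborSet y))
  have e := Set.ncard_union_le (G.neighborSet y ∩ ball G x ℓ) (D ∩ G.neighborSet y)
  nlinarith

lemma newly {V : Type} [Finite V] {G : SimpleGraph V} {y : V} {A B : Set V} (hAB : A ⊆ B) :
    ((G.neighborSet y ∩ B).ncard : ℝ) =
      (G.neighborSet y ∩ A).ncard + (G.neighborSet y ∩ (B \ A)).ncard := by
  rw [← Nat.cast_add, ← Set.ncard_union_eq]
  · congr 2
    ext z
    have := @hAB z
    simp only [Set.mem_inter_iff, Set.mem_union, Set.mem_sdiff]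
    tauto
  · rw [Set.disjoint_left]
    rintro z hz hz'
    exact hz'.2.2 hz.2

lemma core (K : ℕ) {V : Type} [Finite V] (G : SimpleGraph V) (hP1 : P1 K G) (hP2 : P2 K G)
    (hP3 : P3 K G) (x : V) (k m : ℕ) (p t S : ℝ) (h0 : 0 ≤ p) (h1 : p ≤ 1) (ht : 0 ≤ t)
    (hS : 0 < S) (hk : (k : ℝ) + 1 ≤ gam (deg G x))
    (hm : ∀ e : ℕ, |(deg G x : ℤ) - e| ≤ K → (m : ℝ) + 2 * K ≤ gam e)
    (hz : ∀ e : ℕ, |(deg G x : ℤ) - e| ≤ 2 * K → t + p * e ≤ e / 2 - 2 * gam e - 4 * K)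
    (hS' : ((k * m * (deg G x + 2 * K) + k ^ 2 * (deg G x + 2 * K) + (k * m) ^ 2 : ℕ) : ℝ) ≤ S) :
    prob p (fun A0 => x ∈ hatIter G A0 3 \ hatIter G A0 2) ≤
      ((deg G x).choose k : ℝ) * ((k * (deg G x + K)).choose (k * m) : ℝ) *
        Real.exp (-(2 * (k * m * t) ^ 2 / S)) := by
  classical
  have := Fintype.ofFinite V
  obtain ⟨D, hD⟩ := hP3 x
  let S1 : Finset V := (sphere G x 1 \ D).toFinset
  let S2 : Finset V := (sphere G x 2 \ D).toFinset
  let S3 : Finset V := (sphere G x 3 \ D).toFinset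
  let N : V → Finset V := fun z => S3.filter (fun w => G.Adj z w)
  let E' : Finset V → Finset (V × V) := fun Y => (Y ×ˢ S2).filter (fun q => G.Adj q.1 q.2)
  have hS1 : ∀ y, y ∈ S1 ↔ y ∈ sphere G x 1 \ D := fun y => by simp [S1]
  have hS2 : ∀ y, y ∈ S2 ↔ y ∈ sphere G x 2 \ D := fun y => by simp [S2]
  have hS3 : ∀ y, y ∈ S3 ↔ y ∈ sphere G x 3 \ D := fun y => by simp [S3]
  have hsph1 : ∀ y, y ∈ sphere G x 1 ↔ G.Adj x y := by
    intro y
    unfold sphere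
    simp only [Set.mem_ofPred_eq, Nat.cast_one]
    exact SimpleGraph.edist_eq_one_iff_adj
  have hS1card : S1.card ≤ deg G x := by
    unfold deg
    rw [← Set.ncard_coe_finset]
    refine Set.ncard_le_ncard ?_ (Set.toFinite _)
    intro y hy
    exact (hsph1 y).1 ((hS1 y).1 hy).1
  have hdeg1 : ∀ y ∈ S1, |(deg G x : ℤ) - deg G y| ≤ K := by
    intro y hy
    simpa using hP1 x 1 le_rfl y ((hS1 y).1 hy).1
  have hdeg2 : ∀ y ∈ S2, |(deg G x : ℤ) - deg G y| ≤ 2 * K := by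
    intro y hy
    have := hP1 x 2 (by norm_num) y ((hS2 y).1 hy).1
    push_cast at this
    linarith
  have hEsum : ∀ Y, ∀ Q : V → Prop, ((E' Y).filter (fun q => Q q.2)).card =
      ∑ y ∈ Y, (S2.filter (fun z => G.Adj y z ∧ Q z)).card := by
    intro Y Q
    simp only [E', Finset.filter_filter, Finset.card_filter, Finset.sum_product]
  have hE : ∀ Y ∈ S1.powersetCard k, (E' Y).card ≤ k * (deg G x + K) := by
    intro Y hY
    rw [Finset.mem_powersetCard] at hY
    have := hEsum Y (fun _ => True)
    simp only [Finset.filter_true, and_true] at this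
    rw [this, ← hY.2, ← smul_eq_mul]
    refine Finset.sum_le_card_nsmul _ _ _ fun y hy => ?_
    have h1 := hdeg1 y (hY.1 hy)
    have h2 : (S2.filter (fun z => G.Adj y z)).card ≤ deg G y := by
      unfold deg
      rw [← Set.ncard_coe_finset]
      refine Set.ncard_le_ncard ?_ (Set.toFinite _)
      intro z hz
      simp at hz
      exact hz.2
    rw [abs_le] at h1
    omega
  let I : Finset ((_ : Finset V) × Finset (V × V)) :=
    (S1.powersetCard k).sigma (fun Y => (E' Y).powersetCard (k * m))
  have hI : (I.card : ℝ) ≤ ((deg G x).choose k : ℝ) * ((k * (deg G x + K)).choose (k * m) : ℝ) := by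
    norm_cast
    simp only [I, Finset.card_sigma, Finset.card_powersetCard]
    calc _ ≤ (S1.powersetCard k).card • ((k * (deg G x + K)).choose (k * m)) :=
          Finset.sum_le_card_nsmul _ _ _ fun Y hY => Nat.choose_le_choose _ (hE Y hY)
      _ ≤ _ := by
        rw [smul_eq_mul, Finset.card_powersetCard]
        exact Nat.mul_le_mul_right _ (Nat.choose_le_choose _ hS1card)
  let F : ((_ : Finset V) × Finset (V × V)) → Set V → Prop := fun i A =>
    ∀ q ∈ i.2, (deg G q.2 : ℝ) / 2 - 2 * gam (deg G q.2) ≤ ((G.neighborSet q.2 ∩ A).ncard : ℝ)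
  have hcover : ∀ A, (x ∈ hatIter G A 3 \ hatIter G A 2) → ∃ i ∈ I, F i A := by
    intro A hx
    have mono : ∀ n, hatIter G A n ⊆ hatIter G A (n + 1) := by
      intro n
      rw [hatIter]
      exact Set.subset_union_left
    obtain ⟨hx3, hx2⟩ := hx
    have hx3' : (deg G x : ℝ) / 2 ≤ ((G.neighborSet x ∩ hatIter G A 2).ncard : ℝ) := by
      rw [hatIter] at hx3
      simpa using hx3.resolve_left hx2
    have hx2' : ((G.neighborSet x ∩ hatIter G A 1).ncard : ℝ) <
        (deg G x : ℝ) / 2 - gam (deg G x) := by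
      by_contra! hcon
      apply hx2
      rw [hatIter]
      right
      simpa [gamma'_eq] using hcon
    have hy : ∀ y ∈ hatIter G A 2 \ hatIter G A 1,
        gam (deg G y) ≤ ((G.neighborSet y ∩ (hatIter G A 1 \ hatIter G A 0)).ncard : ℝ) := by
      rintro y ⟨hy2, hy1⟩
      have a : (deg G y : ℝ) / 2 - gam (deg G y) ≤
          ((G.neighborSet y ∩ hatIter G A 1).ncard : ℝ) := by
        rw [hatIter] at hy2
        simpa [gamma'_eq] using hy2.resolve_left hy1
      have b : ((G.neighborSet y ∩ hatIter G A 0).ncard : ℝ) <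
        (deg G y : ℝ) / 2 - 2 * gam (deg G y) := by
        by_contra! hcon
        apply hy1
        rw [hatIter]
        right
        simpa [gamma'_eq] using hcon
      have c := newly (G := G) (y := y) (mono 0)
      linarith
    have hzz : ∀ z ∈ hatIter G A 1 \ hatIter G A 0,
        (deg G z : ℝ) / 2 - 2 * gam (deg G z) ≤ ((G.neighborSet z ∩ A).ncard : ℝ) := by
      rintro z ⟨hz1, hz0⟩
      rw [hatIter] at hz1
      simpa [gamma'_eq, hatIter] using hz1.resolve_left hz0
    have hnew := newly (G := G) (y := x) (mono 1)
    -- the available `y`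
    let Y0 : Finset V := S1.filter (fun y => y ∈ hatIter G A 2 \ hatIter G A 1)
    have hY0 : k ≤ Y0.card := by
      have hsub : G.neighborSet x ∩ (hatIter G A 2 \ hatIter G A 1) ⊆
          (Y0 : Set V) ∪ (D ∩ sphere G x 1) := by
        intro y hy
        by_cases hyD : y ∈ D
        · right; exact ⟨hyD, (hsph1 y).2 hy.1⟩
        · left
          simp only [Y0, Finset.coe_filter, Set.mem_ofPred_eq]
          exact ⟨(hS1 y).2 ⟨(hsph1 y).2 hy.1, hyD⟩, hy.2⟩
      have a := Set.ncard_le_ncard hsub (Set.toFinite _)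
      have b := Set.ncard_union_le (Y0 : Set V) (D ∩ sphere G x 1)
      have c := (hD.2 1 le_rfl).1
      simp only [tsub_self, pow_zero, mul_one] at c
      rw [Set.ncard_coe_finset] at b
      have d : (k : ℝ) + 1 ≤ Y0.card + 1 := by
        have : ((G.neighborSet x ∩ (hatIter G A 2 \ hatIter G A 1)).ncard : ℝ) ≤ Y0.card + 1 := by
          exact_mod_cast (by omega)
        simp only [Nat.reduceAdd] at hnew
        linarith
      exact_mod_cast (by linarith : (k : ℝ) ≤ Y0.card)
    obtain ⟨Y, hYsub, hYcard⟩ := Finset.exists_subset_card_eq hY0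
    have hYS1 : ∀ y ∈ Y, y ∈ S1 := fun y hy => (Finset.mem_filter.1 (hYsub hy)).1
    have hYnew : ∀ y ∈ Y, y ∈ hatIter G A 2 \ hatIter G A 1 :=
      fun y hy => (Finset.mem_filter.1 (hYsub hy)).2
    have hPcard : k * m ≤
        ((E' Y).filter (fun q => q.2 ∈ hatIter G A 1 \ hatIter G A 0)).card := by
      have hs : ((E' Y).filter (fun q => q.2 ∈ hatIter G A 1 \ hatIter G A 0)).card =
          ∑ y ∈ Y, (S2.filter
            (fun z => G.Adj y z ∧ z ∈ hatIter G A 1 \ hatIter G A 0)).card := by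
        convert hEsum Y (fun z => z ∈ hatIter G A 1 \ hatIter G A 0)
      rw [hs, ← hYcard, ← smul_eq_mul]
      refine Finset.card_nsmul_le_sum _ _ _ fun y hyY => ?_
      have a := hy y (hYnew y hyY)
      have b := forward_count le_rfl hP2 hD ((hS1 y).1 (hYS1 y hyY))
        (hatIter G A 1 \ hatIter G A 0)
      have c := hm _ (hdeg1 y (hYS1 y hyY))
      have e : G.neighborSet y ∩ (hatIter G A 1 \ hatIter G A 0) ∩ (sphere G x (1 + 1) \ D) =
          ((S2.filter (fun z => G.Adj y z ∧ z ∈ hatIter G A 1 \ hatIter G A 0) : Finset V) :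
            Set V) := by
        ext z
        simp only [Finset.coe_filter, Set.mem_ofPred_eq, hS2, Set.mem_inter_iff,
          SimpleGraph.mem_neighborSet, Nat.reduceAdd]
        tauto
      rw [e, Set.ncard_coe_finset] at b
      have b' : ((G.neighborSet y ∩ (hatIter G A 1 \ hatIter G A 0)).ncard : ℝ) ≤
          ((S2.filter (fun z => G.Adj y z ∧ z ∈ hatIter G A 1 \ hatIter G A 0)).card : ℝ)
            + 2 * K * 1 := by exact_mod_cast b
      exact_mod_cast (by linarith : (m : ℝ) ≤
        ((S2.filter (fun z => G.Adj y z ∧ z ∈ hatIter G A 1 \ hatIter G A 0)).card : ℝ))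
    obtain ⟨P, hPsub, hPc⟩ := Finset.exists_subset_card_eq hPcard
    refine ⟨⟨Y, P⟩, ?_, ?_⟩
    · simp only [I, Finset.mem_sigma, Finset.mem_powersetCard]
      exact ⟨⟨hYS1, hYcard⟩, fun q hq => (Finset.mem_filter.1 (hPsub hq)).1, hPc⟩
    · intro q hq
      exact hzz _ (Finset.mem_filter.1 (hPsub hq)).2
  have hN : ∀ z, ∀ A : Finset V, (G.neighborSet z ∩ (A : Set V) ∩ (sphere G x (2 + 1) \ D)) =
      ((A.filter (fun w => w ∈ N z) : Finset V) : Set V) := by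
    intro z A
    ext w
    simp only [N, Finset.coe_filter, Set.mem_ofPred_eq, Finset.mem_filter, hS3, Set.mem_inter_iff,
          SimpleGraph.mem_neighborSet, Nat.reduceAdd, Finset.mem_coe]
    tauto
  have hNdeg : ∀ z, (N z).card ≤ deg G z := by
    intro z
    unfold deg
    rw [← Set.ncard_coe_finset]
    refine Set.ncard_le_ncard ?_ (Set.toFinite _)
    intro w hw
    simp [N] at hw
    exact hw.2
  have hFi : ∀ i ∈ I, prob p (F i) ≤ Real.exp (-(2 * (k * m * t) ^ 2 / S)) := by
    rintro ⟨Y, P⟩ hi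
    simp only [I, Finset.mem_sigma, Finset.mem_powersetCard] at hi
    obtain ⟨⟨hYS1, hYcard⟩, hPE, hPc⟩ := hi
    have hPE' : ∀ q ∈ P, q.1 ∈ Y ∧ q.2 ∈ S2 ∧ G.Adj q.1 q.2 := by
      intro q hq
      have := hPE hq
      simp only [E', Finset.mem_filter, Finset.mem_product] at this
      tauto
    have sm := second_moment N P Y (deg G x + 2 * K) k hYcard (fun q hq => (hPE' q hq).1)
      (by
        intro q hq
        have a := hNdeg q.2
        have b := hdeg2 q.2 (hPE' q hq).2.1
        rw [abs_le] at b
        omega)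
      (by
        intro q hq q' hq' hne
        have a := (hD.2 2 (by norm_num)).2.2.1 q.2 ((hS2 _).1 (hPE' q hq).2.1) q'.2
          ((hS2 _).1 (hPE' q' hq').2.1) hne
        rw [← Set.ncard_coe_finset]
        refine le_trans (Set.ncard_le_ncard ?_ (Set.toFinite _)) a
        intro w hw
        simp only [N, Finset.coe_inter, Finset.coe_filter, Set.mem_inter_iff, Set.mem_ofPred_eq,
          hS3] at hw
        exact ⟨⟨hw.1.2, hw.2.2⟩, hw.1.1⟩)
      (by
        intro y z w w' h1 h2 h3 h4 hne
        have a := (hD.2 1 le_rfl).2.2.1 y ((hS1 _).1 (hYS1 (hPE' _ h1).1)) z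
          ((hS1 _).1 (hYS1 (hPE' _ h2).1)) hne
        rw [Set.ncard_le_one (Set.toFinite _)] at a
        refine a w ⟨⟨(hPE' _ h1).2.2, (hPE' _ h2).2.2⟩, ?_⟩ w' ⟨⟨(hPE' _ h3).2.2,
          (hPE' _ h4).2.2⟩, ?_⟩
        · exact (hS2 _).1 (hPE' _ h1).2.1
        · exact (hS2 _).1 (hPE' _ h3).2.1)
    rw [hPc] at sm
    let mw : V → ℝ := fun w => ((P.filter (fun q => w ∈ N q.2)).card : ℝ)
    have sm' : ∑ w, mw w ^ 2 ≤ S := by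
      refine le_trans ?_ hS'
      simp only [mw]
      exact_mod_cast sm
    have hsum : ∀ A : Finset V, ∑ w ∈ A, mw w = ∑ q ∈ P, ((A.filter (fun w => w ∈ N q.2)).card : ℝ) := by
      intro A
      simp only [mw, Finset.card_filter]
      push_cast
      rw [Finset.sum_comm]
    have hl : 0 ≤ 4 * (k * m * t) / S := by positivity
    refine le_trans (prob_hoeffding p h0 h1 _ mw (k * m * t) (4 * (k * m * t) / S) hl ?_) ?_
    · intro A hA
      rw [hsum, hsum]
      have hc : (k * m * t : ℝ) = ∑ q ∈ P, t := by
        rw [Finset.sum_const, hPc, nsmul_eq_mul]; push_cast; ring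
      rw [hc, Finset.mul_sum, ← Finset.sum_add_distrib]
      refine Finset.sum_le_sum fun q hq => ?_
      have a := hA q hq
      have b := forward_count (by norm_num) hP2 hD ((hS2 _).1 (hPE' q hq).2.1) (A : Set V)
      rw [hN, Set.ncard_coe_finset] at b
      have c := hz _ (hdeg2 _ (hPE' q hq).2.1)
      have e : ((Finset.univ.filter (fun w => w ∈ N q.2)).card : ℝ) ≤ deg G q.2 := by
        have h1 := hNdeg q.2
        have h2 : Finset.univ.filter (fun w => w ∈ N q.2) = N q.2 := by ext; simp
        rw [h2]
        exact_mod_cast h1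
      have e' := mul_le_mul_of_nonneg_left e h0
      have b' : ((G.neighborSet q.2 ∩ (A : Set V)).ncard : ℝ) ≤
        ((A.filter (fun w => w ∈ N q.2)).card : ℝ) + 2 * K * 2 := by exact_mod_cast b
      linarith
    · rw [Real.exp_le_exp]
      have : (4 * (k * m * t) / S) ^ 2 / 8 * ∑ w, mw w ^ 2 ≤ (4 * (k * m * t) / S) ^ 2 / 8 * S :=
        mul_le_mul_of_nonneg_left sm' (by positivity)
      have e : (4 * (k * m * t) / S) ^ 2 / 8 * S = 2 * (k * m * t) ^ 2 / S := by
        field_simp; ring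
      have e2 : 4 * (k * m * t) / S * (k * m * t) = 4 * (k * m * t) ^ 2 / S := by ring
      have e3 : 4 * (k * m * t) ^ 2 / S = 2 * (2 * (k * m * t) ^ 2 / S) := by ring
      linarith
  calc _ ≤ ∑ i ∈ I, prob p (F i) := prob_le_sum p h0 h1 I _ F hcover
    _ ≤ I.card • Real.exp (-(2 * (k * m * t) ^ 2 / S)) := Finset.sum_le_card_nsmul _ _ _ hFi
    _ ≤ _ := by
      rw [nsmul_eq_mul]
      exact mul_le_mul_of_nonneg_right hI (Real.exp_pos _).le

lemma choose_le_exp (n r : ℕ) (u : ℝ) (hr : 0 < r) (hn : 0 < n)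
    (h : 1 + Real.log ((n : ℝ) / r) ≤ u) : (n.choose r : ℝ) ≤ Real.exp (r * u) := by
  have hr' : (0 : ℝ) < r := by exact_mod_cast hr
  have hn' : (0 : ℝ) < n := by exact_mod_cast hn
  have a : (n.choose r : ℝ) ≤ (n : ℝ) ^ r / r.factorial := Nat.choose_le_pow_div r n
  have b : (r : ℝ) ^ r / r.factorial ≤ Real.exp r := Real.pow_div_factorial_le_exp r hr'.le r
  have hf : (0 : ℝ) < r.factorial := by exact_mod_cast r.factorial_pos
  calc (n.choose r : ℝ) ≤ (n : ℝ) ^ r / r.factorial := a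
    _ = ((n : ℝ) / r) ^ r * ((r : ℝ) ^ r / r.factorial) := by
      rw [div_pow]; field_simp
    _ ≤ ((n : ℝ) / r) ^ r * Real.exp r := mul_le_mul_of_nonneg_left b (by positivity)
    _ = Real.exp (r * (1 + Real.log ((n : ℝ) / r))) := by
      rw [mul_add, Real.exp_add, mul_one, Real.exp_nat_mul _ r, Real.exp_log (by positivity)]
      ring
    _ ≤ _ := by
      rw [Real.exp_le_exp]
      exact mul_le_mul_of_nonneg_left h hr'.le

lemma gam_sq (d : ℕ) : gam d ^ 2 = d / Real.sqrt (Real.log d) := by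
  unfold gam
  rw [Real.sq_sqrt (by positivity)]

lemma gam_nonneg (d : ℕ) : 0 ≤ gam d := Real.sqrt_nonneg _

lemma gam_lower (d : ℕ) (hd : 3 ≤ d) : Real.sqrt (Real.sqrt d) ≤ gam d := by
  have hd' : (3 : ℝ) ≤ d := by exact_mod_cast hd
  have hL : 0 < Real.log d := Real.log_pos (by linarith)
  unfold gam
  apply Real.sqrt_le_sqrt
  rw [le_div_iff₀ (Real.sqrt_pos.2 hL)]
  calc Real.sqrt d * Real.sqrt (Real.log d) ≤ Real.sqrt d * Real.sqrt d := by
        refine mul_le_mul_of_nonneg_left (Real.sqrt_le_sqrt ?_) (Real.sqrt_nonneg _)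
        have := Real.log_le_sub_one_of_pos (show (0 : ℝ) < d by linarith)
        linarith
    _ = d := Real.mul_self_sqrt (by linarith)

lemma tendsto_gam : Tendsto gam atTop atTop := by
  have h : Tendsto (fun d : ℕ => Real.sqrt (Real.sqrt d)) atTop atTop :=
    Real.tendsto_sqrt_atTop.comp (Real.tendsto_sqrt_atTop.comp tendsto_natCast_atTop_atTop)
  refine tendsto_atTop_mono' _ ?_ h
  filter_upwards [eventually_ge_atTop 3] with d hd using gam_lower d hd

lemma one_le_log {u : ℝ} (h : 3 ≤ u) : 1 ≤ Real.log u := by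
  rw [Real.le_log_iff_exp_le (by linarith)]
  have := Real.exp_one_lt_d9
  linarith

set_option maxHeartbeats 1000000 in
lemma numeric (K : ℕ) (c : ℝ) (hc : 1 / 2 < c) :
    ∃ β : ℝ, 0 < β ∧ ∃ D₀ : ℕ, ∀ d : ℕ, D₀ ≤ d → ∃ (k m : ℕ) (t S : ℝ),
      0 ≤ 1 / 2 - c * Real.sqrt (Real.log d / d) ∧ 1 / 2 - c * Real.sqrt (Real.log d / d) ≤ 1 ∧
      0 ≤ t ∧ 0 < S ∧ (k : ℝ) + 1 ≤ gam d ∧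
      (∀ e : ℕ, |(d : ℤ) - e| ≤ K → (m : ℝ) + 2 * K ≤ gam e) ∧
      (∀ e : ℕ, |(d : ℤ) - e| ≤ 2 * K →
        t + (1 / 2 - c * Real.sqrt (Real.log d / d)) * e ≤ e / 2 - 2 * gam e - 4 * K) ∧
      ((k * m * (d + 2 * K) + k ^ 2 * (d + 2 * K) + (k * m) ^ 2 : ℕ) : ℝ) ≤ S ∧
      (d.choose k : ℝ) * ((k * (d + K)).choose (k * m) : ℝ) *
        Real.exp (-(2 * (k * m * t) ^ 2 / S)) ≤ Real.exp (-(β * gam d ^ 2 * Real.log d)) := by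
  obtain ⟨c', hc'⟩ : ∃ c' : ℝ, c' = (c + 1 / 2) / 2 := ⟨_, rfl⟩
  have hc1 : 1 / 2 < c' := by linarith
  have hc2 : c' < c := by linarith
  obtain ⟨η, hη⟩ : ∃ η : ℝ, 2 * c' ^ 2 = 1 / 2 + 4 * η := ⟨(2 * c' ^ 2 - 1 / 2) / 4, by ring⟩
  have hη0 : 0 < η := by nlinarith
  obtain ⟨R, hR⟩ := exists_nat_ge ((1 + 6 * η) / η + 1)
  have hR1 : (1 : ℝ) ≤ R := by
    have : 0 < (1 + 6 * η) / η := by positivity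
    linarith
  have hRη : 1 + 6 * η ≤ η * R := by
    have : (1 + 6 * η) / η ≤ R := by linarith
    rw [div_le_iff₀ hη0] at this
    linarith
  refine ⟨η / (64 * R), by positivity, ?_⟩
  have hlogT : Tendsto (fun d : ℕ => Real.log d) atTop atTop :=
    Real.tendsto_log_atTop.comp tendsto_natCast_atTop_atTop
  have hsqT : Tendsto (fun d : ℕ => Real.sqrt d) atTop atTop :=
    Real.tendsto_sqrt_atTop.comp tendsto_natCast_atTop_atTop
  have hp : ∀ᶠ d : ℕ in atTop, c * Real.sqrt (Real.log d / d) ≤ 1 / 2 := by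
    have h1 : Tendsto (fun u : ℝ => Real.log u / u) atTop (nhds 0) := by
      simpa using Real.tendsto_pow_log_div_mul_add_atTop 1 0 1 one_ne_zero
    have h2 : Tendsto (fun d : ℕ => c * Real.sqrt (Real.log d / d)) atTop (nhds 0) := by
      have := ((h1.comp (tendsto_natCast_atTop_atTop (R := ℝ))).sqrt).const_mul c
      simpa using this
    exact (h2.eventually (gt_mem_nhds (by norm_num : (0 : ℝ) < 1 / 2))).mono fun _ h => le_of_lt h
  have hloglog : ∀ᶠ d : ℕ in atTop,
      1 + Real.log 16 + Real.log (Real.log d) / 4 ≤ η * Real.log d := by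
    have h1 : ∀ᶠ u : ℝ in atTop, ‖Real.log u‖ ≤ η * ‖u‖ := by
      simpa using Real.isLittleO_log_id_atTop.def hη0
    filter_upwards [hlogT.eventually h1,
      hlogT.eventually_ge_atTop (2 * (1 + Real.log 16) / η), hlogT.eventually_ge_atTop 1]
      with d a b e
    rw [div_le_iff₀ hη0] at b
    rw [Real.norm_eq_abs, Real.norm_eq_abs, abs_of_nonneg (by linarith : 0 ≤ Real.log d)] at a
    have := le_abs_self (Real.log (Real.log d))
    have : 0 ≤ η * Real.log d := by positivity
    linarith
  have hL5 := hlogT.eventually_ge_atTop ((5 / (c - c')) ^ 2)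
  have main : ∀ᶠ d : ℕ in atTop, 6 ≤ d ∧ 4 * K ≤ d ∧ 4 * (R + 1) * K ≤ d ∧ 1 ≤ Real.log d ∧
      c * Real.sqrt (Real.log d / d) ≤ 1 / 2 ∧
      1 + Real.log 16 + Real.log (Real.log d) / 4 ≤ η * Real.log d ∧
      ((5 / (c - c')) ^ 2) ≤ Real.log d ∧ (5 * K : ℝ) ≤ Real.sqrt d ∧ (8 * R : ℝ) ≤ gam d ∧
      (8 * K : ℝ) ≤ gam d ∧ 8 / η ≤ gam d := by
    filter_upwards [eventually_ge_atTop 6, eventually_ge_atTop (4 * K),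
      eventually_ge_atTop (4 * (R + 1) * K), hlogT.eventually_ge_atTop 1, hp, hloglog, hL5,
      hsqT.eventually_ge_atTop (5 * K), tendsto_gam.eventually_ge_atTop (8 * R),
      tendsto_gam.eventually_ge_atTop (8 * K), tendsto_gam.eventually_ge_atTop (8 / η)]
      with d h1 h2 h3 h4 h5 h6 h7 h8 h9 h10 h11
    exact ⟨h1, h2, h3, h4, h5, h6, h7, h8, h9, h10, h11⟩
  obtain ⟨D₀, hD₀⟩ := eventually_atTop.1 main
  refine ⟨D₀, fun d hd => ?_⟩
  obtain ⟨h6, h4K, h4R, hL1, hp, hll, hL5, h5K, hgR, hgK, hgη⟩ := hD₀ d hd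
  clear hD₀ main
  have hd6 : (6 : ℝ) ≤ d := by exact_mod_cast h6
  have h4K' : (4 * K : ℝ) ≤ d := by exact_mod_cast h4K
  have h4R' : (4 * (R + 1) * K : ℝ) ≤ d := by exact_mod_cast h4R
  have hd0 : (0 : ℝ) < d := by linarith
  have hR0 : (0 : ℝ) < R := by linarith
  obtain ⟨L, hLdef⟩ : ∃ L, L = Real.log d := ⟨_, rfl⟩
  rw [← hLdef] at hL1 hp hll hL5
  simp only [← hLdef]
  have hL0 : 0 < L := by linarith
  have hg0 : 0 < gam d := by linarith
  have hgd : gam d ^ 2 ≤ d := by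
    rw [gam_sq, ← hLdef]
    exact div_le_self hd0.le (Real.one_le_sqrt.2 hL1)
  -- the parameter k
  obtain ⟨k, hkdef⟩ : ∃ k : ℕ, k = ⌊gam d / (4 * R)⌋₊ := ⟨_, rfl⟩
  have hkle : (k : ℝ) ≤ gam d / (4 * R) := by
    rw [hkdef]; exact Nat.floor_le (by positivity)
  have hklt : gam d / (4 * R) < k + 1 := by
    rw [hkdef]; exact Nat.lt_floor_add_one _
  have h2u : 2 ≤ gam d / (4 * R) := by
    rw [le_div_iff₀ (by positivity)]; linarith
  have hRk1 : (R : ℝ) * k ≤ gam d / 4 := by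
    rw [le_div_iff₀ (by positivity)] at hkle
    linarith
  have hRk2 : gam d / 8 ≤ (R : ℝ) * k := by
    have h : gam d / (4 * R) / 2 ≤ k := by linarith
    have e : gam d / 8 = R * (gam d / (4 * R) / 2) := by field_simp; norm_num
    rw [e]
    exact mul_le_mul_of_nonneg_left h hR0.le
  have hk1 : (1 : ℝ) ≤ k := by linarith
  have hk0 : (0 : ℝ) < k := by linarith
  have hkR : (k : ℝ) ≤ R * k := by nlinarith
  have hsqd : 0 < Real.sqrt d := Real.sqrt_pos.2 hd0
  have hsqL : 0 < Real.sqrt L := Real.sqrt_pos.2 hL0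
  have hsd : Real.sqrt d * Real.sqrt d = d := Real.mul_self_sqrt hd0.le
  have hsL : Real.sqrt L * Real.sqrt L = L := Real.mul_self_sqrt hL0.le
  refine ⟨k, R * k, c' * (Real.sqrt d * Real.sqrt L), k ^ 2 * d * (R + 2), ?_, ?_, ?_, ?_, ?_, ?_,
    ?_, ?_, ?_⟩
  · linarith
  · have : 0 ≤ c * Real.sqrt (L / d) := mul_nonneg (by linarith) (Real.sqrt_nonneg _)
    linarith
  · have : 0 ≤ c' := by linarith
    positivity
  · positivity
  · linarith
  · intro e he
    rw [abs_le] at he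
    have he1 : d ≤ e + K := by omega
    have he2 : e ≤ d + K := by omega
    have he1' : (d : ℝ) ≤ e + K := by exact_mod_cast he1
    have he2' : (e : ℝ) ≤ d + K := by exact_mod_cast he2
    have hle : Real.log e ≤ 4 * L := by
      rw [hLdef, show (4 : ℝ) * Real.log d = Real.log ((d : ℝ) ^ 4) by rw [Real.log_pow]; norm_num]
      refine Real.log_le_log (by linarith) ?_
      have : (2 : ℝ) * d ≤ d ^ 2 := by nlinarith
      have : (d : ℝ) ^ 2 ≤ d ^ 4 := pow_le_pow_right₀ (by linarith) (by norm_num)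
      linarith
    have hle0 : 1 ≤ Real.log e := one_le_log (by linarith)
    have hge : gam d / 2 ≤ gam e := by
      unfold gam
      apply Real.le_sqrt_of_sq_le
      rw [div_pow, Real.sq_sqrt (by positivity), ← hLdef]
      have h1 : Real.sqrt (Real.log e) ≤ 2 * Real.sqrt L := by
        rw [Real.sqrt_le_left (by positivity), mul_pow, Real.sq_sqrt hL0.le]
        linarith
      have h2 : 0 < Real.sqrt (Real.log e) := Real.sqrt_pos.2 (by linarith)
      have e1 : (d : ℝ) / Real.sqrt L / 2 ^ 2 = (d / 2) / (2 * Real.sqrt L) := by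
        field_simp <;> norm_num
      rw [e1]
      apply div_le_div₀ (by positivity) (by linarith) h2 h1
    push_cast
    linarith
  · intro e he
    rw [abs_le] at he
    have he1 : d ≤ e + 2 * K := by omega
    have he2 : e ≤ d + 2 * K := by omega
    have he1' : (d : ℝ) ≤ e + 2 * K := by exact_mod_cast he1
    have he2' : (e : ℝ) ≤ d + 2 * K := by exact_mod_cast he2
    have hle0 : 1 ≤ Real.log e := one_le_log (by linarith)
    have hge : gam e ≤ 2 * Real.sqrt d := by
      unfold gam
      rw [Real.sqrt_le_left (by positivity), mul_pow, Real.sq_sqrt hd0.le]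
      have : (e : ℝ) / Real.sqrt (Real.log e) ≤ e :=
        div_le_self (by positivity) (Real.one_le_sqrt.2 hle0)
      linarith
    have hq : Real.sqrt (L / d) * d = Real.sqrt d * Real.sqrt L := by
      rw [Real.sqrt_div hL0.le]
      field_simp
      rw [sq, hsd]
    have hc0 : 0 ≤ c * Real.sqrt (L / d) := mul_nonneg (by linarith) (Real.sqrt_nonneg _)
    have h1 : c * (Real.sqrt d * Real.sqrt L) - K ≤ c * Real.sqrt (L / d) * e := by
      have a : c * Real.sqrt (L / d) * (d - 2 * K) ≤ c * Real.sqrt (L / d) * e :=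
        mul_le_mul_of_nonneg_left (by linarith) hc0
      have b : c * Real.sqrt (L / d) * (d - 2 * K) =
        c * (Real.sqrt d * Real.sqrt L) - c * Real.sqrt (L / d) * (2 * K) := by
        rw [← hq]; ring
      have b' : c * Real.sqrt (L / d) * (2 * K) ≤ 1 / 2 * (2 * K) :=
        mul_le_mul_of_nonneg_right hp (by positivity)
      linarith
    have h2 : 5 ≤ (c - c') * Real.sqrt L := by
      have a : 5 / (c - c') ≤ Real.sqrt L := Real.le_sqrt_of_sq_le hL5
      rw [div_le_iff₀ (by linarith)] at a
      linarith
    have h3 : 5 * Real.sqrt d ≤ (c - c') * Real.sqrt L * Real.sqrt d :=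
      mul_le_mul_of_nonneg_right h2 hsqd.le
    have : c * (Real.sqrt d * Real.sqrt L) =
      c' * (Real.sqrt d * Real.sqrt L) + (c - c') * Real.sqrt L * Real.sqrt d := by ring
    linarith
  · push_cast
    have h1 : ((R : ℝ) * k) ^ 2 ≤ d / 16 := by
      have : ((R : ℝ) * k) ^ 2 ≤ (gam d / 4) ^ 2 := pow_le_pow_left₀ (by positivity) hRk1 2
      nlinarith
    have h2 : (R + 1) * (2 * K) + ((R : ℝ) * k) ^ 2 ≤ d := by linarith
    have h3 := mul_le_mul_of_nonneg_left h2 (sq_nonneg (k : ℝ))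
    linarith
  · have hM : (0 : ℝ) < R * k ^ 2 := by positivity
    have c1 : (d.choose k : ℝ) ≤ Real.exp (k * L) := by
      calc (d.choose k : ℝ) ≤ (d : ℝ) ^ k := by exact_mod_cast Nat.choose_le_pow d k
        _ = Real.exp (k * L) := by rw [Real.exp_nat_mul, hLdef, Real.exp_log hd0]
    have hlg : Real.log (gam d) = L / 2 - Real.log L / 4 := by
      unfold gam
      rw [Real.log_sqrt (by positivity), Real.log_div hd0.ne' (by rw [← hLdef]; exact hsqL.ne'),
        ← hLdef, Real.log_sqrt hL0.le]
      ring
    have c2 : ((k * (d + K)).choose (k * (R * k)) : ℝ) ≤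
        Real.exp ((k * (R * k) : ℕ) * ((1 / 2 + η) * L)) := by
      have hkn : 0 < k := by exact_mod_cast hk0
      have hRn : 0 < R := by exact_mod_cast hR0
      refine choose_le_exp _ _ _ (by positivity) (Nat.mul_pos hkn (by omega)) ?_
      have a : ((k * (d + K) : ℕ) : ℝ) / ((k * (R * k) : ℕ) : ℝ) ≤ 16 * d / gam d := by
        push_cast
        rw [mul_div_mul_left _ _ hk0.ne', div_le_div_iff₀ (by positivity) hg0]
        have h1 : ((d : ℝ) + K) * gam d ≤ (2 * d) * gam d :=
          mul_le_mul_of_nonneg_right (by linarith) hg0.le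
        have h2 : (d : ℝ) * (gam d / 8) ≤ d * (R * k) := mul_le_mul_of_nonneg_left hRk2 hd0.le
        linarith
      have b := Real.log_le_log (by push_cast; positivity) a
      rw [Real.log_div (by positivity) hg0.ne', Real.log_mul (by norm_num) hd0.ne', ← hLdef,
        hlg] at b
      linarith
    have e3 : 2 * (k * ((R * k : ℕ) : ℝ) * (c' * (Real.sqrt d * Real.sqrt L))) ^ 2 /
        (k ^ 2 * d * (R + 2)) = (1 / 2 + 4 * η) * (R / (R + 2)) * (R * k ^ 2 * L) := by
      rw [← hη]
      push_cast
      simp only [mul_pow, Real.sq_sqrt hd0.le, Real.sq_sqrt hL0.le]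
      field_simp
    rw [e3]
    have h4 : 1 / 2 + 3 * η ≤ (1 / 2 + 4 * η) * (R / (R + 2)) := by
      rw [← mul_div_assoc, le_div_iff₀ (by positivity)]
      nlinarith
    have h5 := mul_le_mul_of_nonneg_right h4 (by positivity : 0 ≤ R * (k : ℝ) ^ 2 * L)
    have h6 : k * L ≤ η * (R * k ^ 2 * L) := by
      have : 1 ≤ η * (R * k) := by
        rw [div_le_iff₀ hη0] at hgη
        have := mul_le_mul_of_nonneg_left hRk2 hη0.le
        linarith
      have := mul_le_mul_of_nonneg_right this (by positivity : 0 ≤ k * L)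
      linarith
    have h7 : η / (64 * R) * gam d ^ 2 * L ≤ η * (R * k ^ 2 * L) := by
      have a : (gam d / 8) ^ 2 ≤ (R * k) ^ 2 := pow_le_pow_left₀ (by positivity) hRk2 2
      have b : η / (64 * R) * gam d ^ 2 * L = η / R * L * (gam d / 8) ^ 2 := by
        field_simp <;> norm_num
      have b' : η * (R * k ^ 2 * L) = η / R * L * (R * k) ^ 2 := by
        field_simp
      rw [b, b']
      exact mul_le_mul_of_nonneg_left a (by positivity)
    calc _ ≤ Real.exp (k * L) * Real.exp ((k * (R * k) : ℕ) * ((1 / 2 + η) * L)) *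
          Real.exp (-((1 / 2 + 4 * η) * (R / (R + 2)) * (R * k ^ 2 * L))) := by
          gcongr
      _ ≤ _ := by
        rw [← Real.exp_add, ← Real.exp_add, Real.exp_le_exp]
        push_cast
        linarith

/-- Lemma: the `Boot₂(γ)` process rarely infects in round three. -/
theorem statement7 (K : ℕ) (c : ℝ) (hc : 1 / 2 < c) :
    ∃ β : ℝ, 0 < β ∧ ∃ D₀ : ℕ, ∀ (V : Type) [Finite V], ∀ G : SimpleGraph V,
      InH K G → D₀ ≤ minDeg G → ∀ x : V,
      prob (1 / 2 - c * Real.sqrt (Real.log (deg G x) / (deg G x)))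
          (fun A0 => x ∈ hatIter G A0 3 \ hatIter G A0 2)
        ≤ Real.exp (-(β * (gamma' G x) ^ 2 * Real.log (deg G x))) := by
  obtain ⟨β, hβ, D₀, h⟩ := numeric K c hc
  refine ⟨β, hβ, D₀ + 1, ?_⟩
  intro V _ G hG hmin x
  have hdeg : minDeg G ≤ deg G x := Nat.sInf_le ⟨x, rfl⟩
  obtain ⟨k, m, t, S, a1, a2, a3, a4, a5, a6, a7, a8, a9⟩ := h (deg G x) (by omega)
  have hP : P1 K G ∧ P2 K G ∧ P3 K G := by
    have hcard : Nat.card V ≠ 1 := by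
      intro h1
      have hs : Subsingleton V := (Nat.card_eq_one_iff_unique.1 h1).1
      have h0 : deg G x = 0 := by
        unfold deg
        rw [Set.ncard_eq_zero (Set.toFinite _), Set.eq_empty_iff_forall_notMem]
        intro y hy
        exact G.ne_of_adj hy (Subsingleton.elim _ _)
      omega
    obtain ⟨n, hn⟩ := hG
    cases n with
    | zero => exact absurd hn hcard
    | succ n =>
      rcases hn with h1 | h1
      · exact absurd h1 hcard
      · exact ⟨h1.1, h1.2.1, h1.2.2.1⟩
  exact le_trans (core K G hP.1 hP.2.1 hP.2.2 x k m _ t S a1 a2 a3 a4 a5 a6 a7 a8) a9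

end MBP
end

section
/- For all constants C ∈ ℝ, 0 < c < 1/2, a ≥ 1 and ε > 0 there exists d₀ such that the following holds: for all integers d ≥ d₀ and all integers d' with d/a ≤ d' ≤ a·d, setting p := 1/2 − c·√(log d/d), one has (1−ε)·Pr[Bin(d',p) ≥ d'/2] ≤ Pr[Bin(d',p) ≥ d'/2 + C] ≤ (1+ε)·Pr[Bin(d',p) ≥ d'/2]. -/
open SimpleGraph Filter

namespace MBP

/-- Point probability of the binomial distribution. -/
noncomputable def bpt (n : ℕ) (p : ℝ) (k : ℕ) : ℝ :=
  (n.choose k : ℝ) * p ^ k * (1 - p) ^ (n - k)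

lemma bpt_nonneg (n : ℕ) (p : ℝ) (hp : 0 ≤ p) (hp1 : p ≤ 1) (k : ℕ) : 0 ≤ bpt n p k := by
  have : 0 ≤ 1 - p := by linarith
  unfold bpt; positivity

lemma bpt_step (n : ℕ) (p s : ℝ) (hp : 0 ≤ p) (hp1 : p < 1) (hs1 : s ≤ 1)
    (hpq : (1 - s) * (1 - p) ≤ p) (k : ℕ) (hk : k < n)
    (hnk : (1 - s) * ((k : ℝ) + 1) ≤ (n : ℝ) - k) :
    (1 - s) ^ 2 * bpt n p k ≤ bpt n p (k + 1) := by
  obtain ⟨m, rfl⟩ : ∃ m, n = k + 1 + m := ⟨n - (k + 1), by omega⟩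
  have hch : ((k + 1 + m).choose (k + 1) : ℝ) * (k + 1) = ((k + 1 + m).choose k : ℝ) * (m + 1) := by
    have h := Nat.choose_succ_right_eq (k + 1 + m) k
    have h2 : k + 1 + m - k = m + 1 := by omega
    rw [h2] at h
    exact_mod_cast h
  have e1 : k + 1 + m - k = m + 1 := by omega
  have e2 : k + 1 + m - (k + 1) = m := by omega
  unfold bpt
  rw [e1, e2]
  have hnk' : (1 - s) * ((k : ℝ) + 1) ≤ m + 1 := by push_cast at hnk; linarith
  have hq : 0 < 1 - p := by linarith
  have hs : 0 ≤ 1 - s := by linarith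
  have hprod : ((1 - s) * (1 - p)) * ((1 - s) * ((k : ℝ) + 1)) ≤ p * (m + 1) := by
    apply mul_le_mul hpq hnk' _ hp
    positivity
  have hk1 : (0 : ℝ) < k + 1 := by positivity
  refine le_of_mul_le_mul_right ?_ hk1
  have hX : 0 ≤ ((k + 1 + m).choose k : ℝ) * p ^ k * (1 - p) ^ m := by positivity
  calc (1 - s) ^ 2 * (((k + 1 + m).choose k : ℝ) * p ^ k * (1 - p) ^ (m + 1)) * (k + 1)
      = (((k + 1 + m).choose k : ℝ) * p ^ k * (1 - p) ^ m) *
          (((1 - s) * (1 - p)) * ((1 - s) * ((k : ℝ) + 1))) := by ring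
    _ ≤ (((k + 1 + m).choose k : ℝ) * p ^ k * (1 - p) ^ m) * (p * (m + 1)) :=
        mul_le_mul_of_nonneg_left hprod hX
    _ = (((k + 1 + m).choose k : ℝ) * (m + 1)) * (p ^ (k + 1) * (1 - p) ^ m) := by ring
    _ = _ := by rw [← hch]; ring

lemma bpt_iter (n L : ℕ) (p : ℝ) (hL : 1 ≤ L) (hp : 0 ≤ p) (hp1 : p < 1)
    (hpq : (1 - 1 / (4 * (L : ℝ))) * (1 - p) ≤ p) (hn : 8 * L * (2 * L + 1) ≤ n)
    (k : ℕ) (j : ℕ) (hj : j ≤ L) (hkj : 2 * (k + j) ≤ n + 2 * L) :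
    bpt n p k / 2 ≤ bpt n p (k + j) := by
  have hL0 : (1 : ℝ) ≤ L := by exact_mod_cast hL
  set s : ℝ := 1 / (4 * (L : ℝ)) with hs
  have hs0 : 0 < s := by positivity
  have hsL : s * (4 * L) = 1 := by rw [hs]; field_simp
  have hs1 : s ≤ 1 := by nlinarith
  have hnR : 8 * (L : ℝ) * (2 * L + 1) ≤ n := by exact_mod_cast hn
  have hb := bpt_nonneg n p hp hp1.le k
  have key : ∀ i, i ≤ j → ((1 - s) ^ 2) ^ i * bpt n p k ≤ bpt n p (k + i) := by
    intro i
    induction i with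
    | zero => intro _; simp
    | succ i ih =>
      intro hi
      have h1 := ih (by omega)
      have hki : 2 * (k + i) ≤ n + 2 * L := by omega
      have hkiR : 2 * ((k + i : ℕ) : ℝ) ≤ n + 2 * L := by exact_mod_cast hki
      have h2 : (1 - s) ^ 2 * bpt n p (k + i) ≤ bpt n p (k + i + 1) := by
        apply bpt_step n p s hp hp1 hs1 hpq
        · nlinarith
        · have : 2 * (2 * L + 1) ≤ s * n := by
            calc 2 * (2 * (L : ℝ) + 1) = s * (8 * (L : ℝ) * (2 * L + 1)) := by
                    linear_combination (-2 * (2 * (L : ℝ) + 1)) * hsL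
              _ ≤ s * n := by gcongr
          nlinarith
      calc ((1 - s) ^ 2) ^ (i + 1) * bpt n p k
          = (1 - s) ^ 2 * (((1 - s) ^ 2) ^ i * bpt n p k) := by ring
        _ ≤ (1 - s) ^ 2 * bpt n p (k + i) := by gcongr
        _ ≤ _ := h2
  have h := key j le_rfl
  have hB : 1 / 2 ≤ ((1 - s) ^ 2) ^ j := by
    have h1 := one_add_mul_le_pow (a := -s) (by linarith) (2 * j)
    have hjR : (j : ℝ) ≤ L := by exact_mod_cast hj
    rw [← pow_mul]
    have h3 : (1 + -s) = 1 - s := by ring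
    rw [h3] at h1
    push_cast at h1
    nlinarith
  nlinarith

lemma binTail_eq (n : ℕ) (p t : ℝ) :
    binTail n p t = ∑ k ∈ Finset.range (n + 1), if t ≤ (k : ℝ) then bpt n p k else 0 := rfl

lemma point_le (n J M : ℕ) (p : ℝ) (hM : 1 ≤ M) (hp : 0 ≤ p) (hp1 : p < 1)
    (hpq : (1 - 1 / (4 * ((2 * J + M : ℕ) : ℝ))) * (1 - p) ≤ p)
    (hn : 8 * (2 * J + M) * (2 * (2 * J + M) + 1) ≤ n)
    (k : ℕ) (h1 : n ≤ 2 * k + 2 * J) (h2 : 2 * k ≤ n + 2 * J) :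
    M * (bpt n p k / 2) ≤ binTail n p ((n : ℝ) / 2) := by
  have hnn : 2 * (2 * J + M) ≤ n := by nlinarith
  rw [binTail_eq]
  calc (M : ℝ) * (bpt n p k / 2) = ∑ _i ∈ Finset.range M, bpt n p k / 2 := by simp
    _ ≤ ∑ i ∈ Finset.range M, bpt n p (k + (J + i)) := by
        apply Finset.sum_le_sum
        intro i hi
        have := Finset.mem_range.1 hi
        exact bpt_iter n (2 * J + M) p (by omega) hp hp1 hpq hn k (J + i) (by omega) (by omega)
    _ = ∑ i ∈ (Finset.range M).image (fun i => k + (J + i)), bpt n p i := by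
        rw [Finset.sum_image]
        intro x _ y _ h
        simp only at h
        omega
    _ = ∑ i ∈ (Finset.range M).image (fun i => k + (J + i)),
          (if (n : ℝ) / 2 ≤ (i : ℝ) then bpt n p i else 0) := by
        apply Finset.sum_congr rfl
        intro x hx
        obtain ⟨i, hi, rfl⟩ := Finset.mem_image.1 hx
        have : n ≤ 2 * (k + (J + i)) := by omega
        have : (n : ℝ) ≤ 2 * ((k + (J + i) : ℕ) : ℝ) := by exact_mod_cast this
        rw [if_pos (by linarith)]
    _ ≤ _ := by
        apply Finset.sum_le_sum_of_subset_of_nonneg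
        · intro x hx
          obtain ⟨i, hi, rfl⟩ := Finset.mem_image.1 hx
          have := Finset.mem_range.1 hi
          rw [Finset.mem_range]
          omega
        · intro i _ _
          have := bpt_nonneg n p hp hp1.le i
          split_ifs <;> simp [this]

lemma diff_le (n J : ℕ) (p C : ℝ) (hp : 0 ≤ p) (hp1 : p < 1) (hJ : |C| ≤ J) (B : ℝ) (hB0 : 0 ≤ B)
    (hB : ∀ k : ℕ, n ≤ 2 * k + 2 * J → 2 * k ≤ n + 2 * J → bpt n p k ≤ B) :
    |binTail n p ((n : ℝ) / 2 + C) - binTail n p ((n : ℝ) / 2)| ≤ (2 * J + 2) * B := by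
  rw [binTail_eq, binTail_eq, ← Finset.sum_sub_distrib]
  obtain ⟨hC1, hC2⟩ := abs_le.1 hJ
  refine (Finset.abs_sum_le_sum_abs _ _).trans ?_
  calc _ ≤ ∑ k ∈ Finset.range (n + 1),
          (if n ≤ 2 * k + 2 * J ∧ 2 * k ≤ n + 2 * J then B else 0) := by
        apply Finset.sum_le_sum
        intro k _
        have hb := bpt_nonneg n p hp hp1.le k
        by_cases h : n ≤ 2 * k + 2 * J ∧ 2 * k ≤ n + 2 * J
        · rw [if_pos h]
          have := hB k h.1 h.2
          split_ifs <;> simp [abs_of_nonneg hb, this, hB0]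
        · rw [if_neg h]
          have : (n : ℝ) > 2 * k + 2 * J ∨ 2 * (k : ℝ) > n + 2 * J := by
            by_contra hcon
            push Not at hcon
            exact h ⟨by exact_mod_cast hcon.1, by exact_mod_cast hcon.2⟩
          rcases this with h3 | h3
          · rw [if_neg (by linarith), if_neg (by linarith)]; simp
          · rw [if_pos (by linarith), if_pos (by linarith)]; simp
    _ = (Finset.card ((Finset.range (n + 1)).filter
          (fun k => n ≤ 2 * k + 2 * J ∧ 2 * k ≤ n + 2 * J)) : ℝ) * B := by
        rw [← Finset.sum_filter]; simp
    _ ≤ _ := by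
        gcongr
        have : Finset.card ((Finset.range (n + 1)).filter
          (fun k => n ≤ 2 * k + 2 * J ∧ 2 * k ≤ n + 2 * J)) ≤ 2 * J + 2 := by
          calc _ ≤ (Finset.Icc (n / 2 - J) (n / 2 + J + 1)).card := by
                apply Finset.card_le_card
                intro k hk
                simp only [Finset.mem_filter, Finset.mem_range] at hk
                rw [Finset.mem_Icc]
                omega
            _ ≤ _ := by rw [Nat.card_Icc]; omega
        exact_mod_cast this

lemma delta_tendsto (c : ℝ) :
    Tendsto (fun d : ℕ => c * Real.sqrt (Real.log d / d)) atTop (nhds 0) := by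
  have h1 : Tendsto (fun x : ℝ => Real.log x / x) atTop (nhds 0) :=
    Real.isLittleO_log_id_atTop.tendsto_div_nhds_zero
  have h2 := (h1.comp tendsto_natCast_atTop_atTop).sqrt.const_mul c
  simpa using h2

/-- binomial tail comparison under a constant shift. -/
theorem statement9 (C c a ε : ℝ) (hc0 : 0 < c) (hc : c < 1 / 2) (ha : 1 ≤ a) (hε : 0 < ε) :
    ∃ d₀ : ℕ, ∀ d : ℕ, d₀ ≤ d → ∀ d' : ℕ,
      (d : ℝ) / a ≤ (d' : ℝ) → (d' : ℝ) ≤ a * d →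
      (1 - ε) * binTail d' (1 / 2 - c * Real.sqrt (Real.log d / d)) ((d' : ℝ) / 2)
          ≤ binTail d' (1 / 2 - c * Real.sqrt (Real.log d / d)) ((d' : ℝ) / 2 + C) ∧
      binTail d' (1 / 2 - c * Real.sqrt (Real.log d / d)) ((d' : ℝ) / 2 + C)
          ≤ (1 + ε) * binTail d' (1 / 2 - c * Real.sqrt (Real.log d / d)) ((d' : ℝ) / 2) := by
  obtain ⟨J, hJ⟩ := exists_nat_ge |C|
  obtain ⟨M, hM⟩ := exists_nat_ge (2 * (2 * (J : ℝ) + 2) / ε)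
  have hMpos : (0 : ℝ) < M := lt_of_lt_of_le (by positivity) hM
  have hM1 : 1 ≤ M := by
    have : 0 < M := by exact_mod_cast hMpos
    omega
  set L : ℕ := 2 * J + M with hL
  have hL1 : (1 : ℝ) ≤ L := by
    have : 1 ≤ L := by omega
    exact_mod_cast this
  set s : ℝ := 1 / (4 * (L : ℝ)) with hs
  have hs0 : 0 < s := by positivity
  have hs1 : s ≤ 1 := by
    rw [hs, div_le_one (by positivity)]; linarith
  obtain ⟨N1, hN1⟩ := Filter.eventually_atTop.1
    ((delta_tendsto c).eventually (gt_mem_nhds (show (0 : ℝ) < s / 4 by positivity)))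
  obtain ⟨N2, hN2⟩ := exists_nat_ge (a * ((8 * L * (2 * L + 1) : ℕ) : ℝ))
  refine ⟨max N1 N2, ?_⟩
  intro d hd n hn1 _
  have hdel := hN1 d (le_trans (le_max_left _ _) hd)
  have hdel0 : 0 ≤ c * Real.sqrt (Real.log d / d) := by positivity
  generalize c * Real.sqrt (Real.log d / d) = δ at *
  have hnbig : 8 * L * (2 * L + 1) ≤ n := by
    have h1 : (N2 : ℝ) ≤ d := by exact_mod_cast le_trans (le_max_right _ _) hd
    have ha0 : 0 < a := by linarith
    rw [div_le_iff₀ ha0] at hn1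
    have h2 : ((8 * L * (2 * L + 1) : ℕ) : ℝ) ≤ n := by
      have : a * ((8 * L * (2 * L + 1) : ℕ) : ℝ) ≤ a * n := by linarith
      exact le_of_mul_le_mul_left this ha0
    exact_mod_cast h2
  have hp : 0 ≤ 1 / 2 - δ := by linarith
  have hp1 : 1 / 2 - δ < 1 := by linarith
  have hpq : (1 - s) * (1 - (1 / 2 - δ)) ≤ 1 / 2 - δ := by nlinarith
  generalize 1 / 2 - δ = p at *
  have hpt := point_le n J M p hM1 hp hp1 hpq hnbig
  set T := binTail n p ((n : ℝ) / 2) with hT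
  have hT0 : 0 ≤ T := by
    rw [hT, binTail_eq]
    apply Finset.sum_nonneg
    intro i _
    have := bpt_nonneg n p hp hp1.le i
    split_ifs <;> simp [this]
  have hdiff := diff_le n J p C hp hp1 hJ (2 * T / M) (by positivity) (by
    intro k h1 h2
    have := hpt k h1 h2
    rw [le_div_iff₀ hMpos]
    linarith)
  have hfin : (2 * (J : ℝ) + 2) * (2 * T / M) ≤ ε * T := by
    rw [div_le_iff₀ hε] at hM
    have : (2 * (J : ℝ) + 2) * (2 * T / M) = (2 * (2 * (J : ℝ) + 2)) * T / M := by ring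
    rw [this, div_le_iff₀ hMpos]
    nlinarith
  obtain ⟨h3, h4⟩ := abs_le.1 (hdiff.trans hfin)
  constructor <;> linarith

end MBP
end

section
/- For every K ∈ ℕ, every m ∈ ℕ∪{0} and every constant 0 < c < 1/2 there exist a > 0 and D₀ such that the following holds. Let G ∈ H(K) be a finite graph with δ(G) ≥ D₀, let x ∈ V(G), write d := d(x), let p := 1/2 − c·√(log d/d), let A₀ be a p-random subset of V(G), and let ℓ be an integer with m ≤ ℓ ≤ d/2 + m. Set X₀ := N(x) ∩ A₀ and X₁ := N(x) ∩ (A₁(m) \ A₀), where (A_i(m)) is the m-shifted bootstrap process started from A₀. Then the conditional expectation satisfies E[ |X₁| | (x ∉ A₀) and (|X₀| ≥ d/2 + m − ℓ) ] ≥ a·d^{1−2c²}/√(log d). -/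
open SimpleGraph Filter

namespace MBP

lemma aux_exp_le {u : ℝ} (h0 : 0 ≤ u) (h1 : u ≤ 1 / 4) : Real.exp (-(u + u ^ 2)) ≤ 1 - u := by
  rw [Real.exp_neg]
  have h2 := Real.quadratic_le_exp_of_nonneg (x := u + u ^ 2) (by positivity)
  have hpos : 0 < Real.exp (u + u ^ 2) := Real.exp_pos _
  rw [inv_le_iff_one_le_mul₀ hpos]
  have h3 : (1 - u) * (1 + (u + u ^ 2) + (u + u ^ 2) ^ 2 / 2) ≤ (1 - u) * Real.exp (u + u ^ 2) :=
    mul_le_mul_of_nonneg_left h2 (by linarith)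
  have h4 : 1 ≤ (1 - u) * (1 + (u + u ^ 2) + (u + u ^ 2) ^ 2 / 2) := by
    have : (1 - u) * (1 + (u + u ^ 2) + (u + u ^ 2) ^ 2 / 2)
        = 1 + u ^ 2 * (1 / 2 - u / 2 - u ^ 2 / 2 - u ^ 3 / 2) := by ring
    rw [this]
    have h5 : u ^ 2 ≤ 1 / 4 := by nlinarith
    have h6 : u ^ 3 ≤ 1 / 4 := by nlinarith [mul_nonneg h0 h0]
    have : 0 ≤ u ^ 2 * (1 / 2 - u / 2 - u ^ 2 / 2 - u ^ 3 / 2) :=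
      mul_nonneg (sq_nonneg u) (by linarith)
    linarith
  linarith

lemma central_lower (n : ℕ) : (16 : ℝ) ^ n * (1 / 4) ≤ max (n : ℝ) (1 / 4) * (n.centralBinom : ℝ) ^ 2 := by
  induction n with
  | zero => norm_num
  | succ n ih =>
    have h := Nat.succ_mul_centralBinom_succ n
    have h' : ((n : ℝ) + 1) * ((n + 1).centralBinom : ℝ) = 2 * (2 * n + 1) * n.centralBinom := by
      exact_mod_cast h
    have hn : (0 : ℝ) ≤ n := Nat.cast_nonneg n
    have hm : max (((n + 1 : ℕ) : ℝ)) (1 / 4) = n + 1 := by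
      push_cast
      exact max_eq_left (by linarith)
    rw [hm]
    have e : ((n : ℝ) + 1) * ((n + 1).centralBinom : ℝ) ^ 2
        = (2 * (2 * n + 1) * n.centralBinom) ^ 2 / (n + 1) := by
      rw [← h']; field_simp
    rw [e, le_div_iff₀ (by positivity), pow_succ]
    have h7 : max (n : ℝ) (1 / 4) * 16 * (n + 1) ≤ (2 * (2 * n + 1)) ^ 2 := by
      rcases max_cases (n : ℝ) (1 / 4) with ⟨h, _⟩ | ⟨h, _⟩ <;> rw [h] <;> nlinarith
    calc (16 : ℝ) ^ n * 16 * (1 / 4) * (n + 1) = (16 ^ n * (1 / 4)) * (16 * (n + 1)) := by ring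
      _ ≤ (max (n : ℝ) (1 / 4) * (n.centralBinom : ℝ) ^ 2) * (16 * (n + 1)) := by gcongr
      _ = (max (n : ℝ) (1 / 4) * 16 * (n + 1)) * (n.centralBinom : ℝ) ^ 2 := by ring
      _ ≤ (2 * (2 * n + 1)) ^ 2 * (n.centralBinom : ℝ) ^ 2 := by gcongr
      _ = _ := by ring

lemma central_lower' (n : ℕ) (hn : 1 ≤ n) :
    (4 : ℝ) ^ n / (2 * Real.sqrt n) ≤ (n.centralBinom : ℝ) := by
  have h := central_lower n
  have hn' : (1 : ℝ) ≤ n := by exact_mod_cast hn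
  rw [max_eq_left (by linarith)] at h
  rw [div_le_iff₀ (by positivity)]
  apply le_of_pow_le_pow_left₀ two_ne_zero (by positivity)
  have : ((4 : ℝ) ^ n) ^ 2 = 16 ^ n := by rw [← pow_mul, mul_comm, pow_mul]; norm_num
  rw [this, mul_pow, mul_pow, Real.sq_sqrt (by linarith)]
  linarith

lemma choose_lower (M s : ℕ) (hM : 1 ≤ M) (hs : s ≤ M) :
    (M.centralBinom : ℝ) * (1 - (s : ℝ) ^ 2 / M) ≤ ((2 * M).choose (M + s) : ℝ) := by
  induction s with
  | zero => simp [Nat.centralBinom]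
  | succ s ih =>
    have ih := ih (by omega)
    have hM' : (1 : ℝ) ≤ M := by exact_mod_cast hM
    have hs' : (s : ℝ) + 1 ≤ M := by exact_mod_cast hs
    have h := Nat.choose_succ_right_eq (2 * M) (M + s)
    have h2 : ((2 * M).choose (M + (s + 1)) : ℝ) * (M + s + 1)
        = ((2 * M).choose (M + s) : ℝ) * (M - s) := by
      have e : 2 * M - (M + s) = M - s := by omega
      rw [e] at h
      have := congrArg (Nat.cast (R := ℝ)) h
      rw [Nat.cast_mul, Nat.cast_mul, Nat.cast_sub (by omega)] at this
      push_cast at this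
      rw [← add_assoc]; exact this
    have h3 : ((2 * M).choose (M + s) : ℝ) ≤ (M.centralBinom : ℝ) := by
      exact_mod_cast Nat.choose_le_centralBinom _ _
    have hs0 : (0 : ℝ) ≤ s := Nat.cast_nonneg s
    have h4 : ((2 * M).choose (M + (s + 1)) : ℝ)
        = ((2 * M).choose (M + s) : ℝ) - ((2 * M).choose (M + s) : ℝ) * ((2 * s + 1) / (M + s + 1)) := by
      have : ((2 * M).choose (M + (s + 1)) : ℝ)
        = ((2 * M).choose (M + s) : ℝ) * (M - s) / (M + s + 1) := by
        rw [← h2]; field_simp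
      rw [this]; field_simp; ring
    have h5 : ((2 * M).choose (M + s) : ℝ) * ((2 * s + 1) / (M + s + 1))
        ≤ (M.centralBinom : ℝ) * ((2 * s + 1) / M) := by
      gcongr
      linarith
    rw [h4]
    have h6 : (M.centralBinom : ℝ) * (1 - ((s + 1 : ℕ) : ℝ) ^ 2 / M)
       = (M.centralBinom : ℝ) * (1 - (s : ℝ) ^ 2 / M) - (M.centralBinom : ℝ) * ((2 * s + 1) / M) := by
      push_cast; ring
    rw [h6]; linarith

set_option maxHeartbeats 1600000 in
lemma term_lower (M s d C : ℕ) (c : ℝ) (hc0 : 0 < c) (hc : c < 1 / 2)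
    (hL : 64 ≤ Real.log d) (hL2 : Real.log d ^ 2 ≤ d)
    (hM : 1 ≤ M) (hMd : 2 * M ≤ d) (hs : (s : ℝ) ≤ C + Real.sqrt (d / Real.log d))
    (hsM : 2 * (s : ℝ) ^ 2 ≤ M) :
    Real.exp (-(8 + 8 * (C + 1))) / (4 * Real.sqrt d) * (d : ℝ) ^ (-(2 * c ^ 2) : ℝ) ≤
      ((2 * M).choose (M + s) : ℝ) * (1 / 2 - c * Real.sqrt (Real.log d / d)) ^ (M + s) *
        (1 - (1 / 2 - c * Real.sqrt (Real.log d / d))) ^ (2 * M - (M + s)) := by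
  have hM' : (1 : ℝ) ≤ M := by exact_mod_cast hM
  have hMd' : 2 * (M : ℝ) ≤ d := by exact_mod_cast hMd
  have hd : (0 : ℝ) < d := by linarith
  have hs0 : (0 : ℝ) ≤ s := Nat.cast_nonneg s
  have hsM2 : s ≤ M := by
    have : 2 * s ^ 2 ≤ M := by exact_mod_cast hsM
    nlinarith
  set L := Real.log d with hLdef
  set r := Real.sqrt (L / d) with hr
  have hr2 : r ^ 2 = L / d := Real.sq_sqrt (by positivity)
  have hr0 : 0 ≤ r := Real.sqrt_nonneg _
  have hrle : r ≤ 1 / 8 := by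
    apply le_of_pow_le_pow_left₀ two_ne_zero (by norm_num)
    rw [hr2, div_le_iff₀ hd]
    nlinarith
  have hrs : r * Real.sqrt (d / L) = 1 := by
    rw [hr, ← Real.sqrt_mul (by positivity)]
    rw [show L / d * (d / L) = 1 by field_simp]; simp
  set ε := c * r with hε
  have hε0 : 0 ≤ ε := by positivity
  have hεle : ε ≤ 1 / 16 := by nlinarith
  have hεs : ε * s ≤ C + 1 := by
    have hC : (0 : ℝ) ≤ C := Nat.cast_nonneg C
    have : r * s ≤ r * C + 1 := by
      calc r * s ≤ r * (C + Real.sqrt (d / L)) := by gcongr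
        _ = _ := by rw [mul_add, hrs]
    have h1 : r * C ≤ 1 * C := by gcongr; linarith
    calc ε * s = c * (r * s) := by rw [hε]; ring
      _ ≤ 1 * (r * s) := by gcongr; linarith
      _ ≤ _ := by linarith
  have hp0 : 0 < 1 / 2 - ε := by linarith
  have hq0 : 0 < 1 - (1 / 2 - ε) := by linarith
  obtain ⟨t, rfl⟩ := Nat.exists_eq_add_of_le hsM2
  have hsub : 2 * (s + t) - (s + t + s) = t := by omega
  rw [hsub]
  have key : (1 / 2 - ε) ^ (s + t + s) * (1 - (1 / 2 - ε)) ^ t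
      = (1 - 4 * ε ^ 2) ^ (s + t) * ((1 / 2 - ε) / (1 - (1 / 2 - ε))) ^ s / 4 ^ (s + t) := by
    have : 1 - 4 * ε ^ 2 = 4 * ((1 / 2 - ε) * (1 - (1 / 2 - ε))) := by ring
    rw [this]
    generalize 1 - (1 / 2 - ε) = q at hq0
    generalize 1 / 2 - ε = p
    rw [mul_pow, mul_pow, div_pow]
    field_simp
    ring
  have b1 : Real.exp (-(2 * c ^ 2 * L) - 8) ≤ (1 - 4 * ε ^ 2) ^ (s + t) := by
    have h := aux_exp_le (u := 4 * ε ^ 2) (by positivity) (by nlinarith)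
    calc Real.exp (-(2 * c ^ 2 * L) - 8) ≤ Real.exp (-(4 * ε ^ 2 + (4 * ε ^ 2) ^ 2)) ^ (s + t) := by
          rw [← Real.exp_nat_mul]
          apply Real.exp_le_exp.mpr
          have e2 : ε ^ 2 = c ^ 2 * (L / d) := by rw [hε, mul_pow, hr2]
          rw [e2]
          set M : ℝ := ((s + t : ℕ) : ℝ) with hMM
          have i1 : M * (4 * (c ^ 2 * (L / d))) ≤ 2 * c ^ 2 * L := by
            have : M * (4 * (c ^ 2 * (L / d))) = 2 * c ^ 2 * L * (2 * M / d) := by ring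
            rw [this]
            have : 2 * M / d ≤ 1 := by rw [div_le_one hd]; exact hMd'
            exact mul_le_of_le_one_right (by positivity) this
          have i2 : M * (4 * (c ^ 2 * (L / d))) ^ 2 ≤ 8 := by
            have : M * (4 * (c ^ 2 * (L / d))) ^ 2 = 8 * (c ^ 4 * ((2 * M / d) * (L ^ 2 / d))) := by
              field_simp; ring
            rw [this]
            have j1 : 2 * M / d ≤ 1 := by rw [div_le_one hd]; exact hMd'
            have j2 : L ^ 2 / d ≤ 1 := by rw [div_le_one hd]; exact hL2
            have j3 : c ^ 4 ≤ 1 := pow_le_one₀ hc0.le (by linarith)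
            have j4 : (2 * M / d) * (L ^ 2 / d) ≤ 1 := mul_le_one₀ j1 (by positivity) j2
            have : c ^ 4 * ((2 * M / d) * (L ^ 2 / d)) ≤ 1 := mul_le_one₀ j3 (by positivity) j4
            linarith
          rw [mul_neg, mul_add]
          linarith
      _ ≤ _ := pow_le_pow_left₀ (Real.exp_pos _).le h _
  have b2 : Real.exp (-(8 * (C + 1))) ≤ ((1 / 2 - ε) / (1 - (1 / 2 - ε))) ^ s := by
    have h := aux_exp_le (u := 4 * ε) (by positivity) (by linarith)
    have h1 : 1 - 4 * ε ≤ (1 / 2 - ε) / (1 - (1 / 2 - ε)) := by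
      rw [le_div_iff₀ hq0]; nlinarith
    calc Real.exp (-(8 * (C + 1))) ≤ Real.exp (-(4 * ε + (4 * ε) ^ 2)) ^ s := by
          rw [← Real.exp_nat_mul]
          apply Real.exp_le_exp.mpr
          have : (4 * ε) ^ 2 ≤ 4 * ε := by nlinarith
          have : (s : ℝ) * (4 * ε + (4 * ε) ^ 2) ≤ s * (8 * ε) :=
            mul_le_mul_of_nonneg_left (by linarith) hs0
          have h9 : (s : ℝ) * (8 * ε) = 8 * (ε * s) := by ring
          rw [mul_neg]
          linarith
      _ ≤ _ := pow_le_pow_left₀ (Real.exp_pos _).le (h.trans h1) _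
  have b3 : (4 : ℝ) ^ (s + t) / (4 * Real.sqrt d) ≤ ((2 * (s + t)).choose (s + t + s) : ℝ) := by
    have h1 := central_lower' (s + t) hM
    have h2 := choose_lower (s + t) s hM hsM2
    have h3 : (1 : ℝ) / 2 ≤ 1 - (s : ℝ) ^ 2 / ((s + t : ℕ) : ℝ) := by
      have : (s : ℝ) ^ 2 / ((s + t : ℕ) : ℝ) ≤ 1 / 2 := by
        rw [div_le_iff₀ (by linarith)]; linarith
      linarith
    calc (4 : ℝ) ^ (s + t) / (4 * Real.sqrt d) = (4 : ℝ) ^ (s + t) / (2 * Real.sqrt d) * (1 / 2) := by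
          field_simp; ring
      _ ≤ (4 : ℝ) ^ (s + t) / (2 * Real.sqrt ((s + t : ℕ) : ℝ)) * (1 / 2) := by
          gcongr
          linarith
      _ ≤ _ := by
          refine le_trans ?_ h2
          gcongr
  have hrp : (d : ℝ) ^ (-(2 * c ^ 2) : ℝ) = Real.exp (-(2 * c ^ 2 * L)) := by
    rw [Real.rpow_def_of_pos hd]; congr 1; ring
  rw [mul_assoc, key, hrp]
  calc Real.exp (-(8 + 8 * (C + 1))) / (4 * Real.sqrt d) * Real.exp (-(2 * c ^ 2 * L))
      = (4 : ℝ) ^ (s + t) / (4 * Real.sqrt d) *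
        (Real.exp (-(2 * c ^ 2 * L) - 8) * Real.exp (-(8 * (C + 1))) / 4 ^ (s + t)) := by
        rw [← Real.exp_add]
        have : -(2 * c ^ 2 * L) - 8 + -(8 * ((C : ℝ) + 1))
          = -(8 + 8 * ((C : ℝ) + 1)) + (-(2 * c ^ 2 * L)) := by ring
        rw [this, Real.exp_add]
        field_simp
    _ ≤ _ := by
        gcongr
        exact (Real.exp_pos _).le.trans b1

lemma tail_lower (K C : ℕ) (c : ℝ) (hc0 : 0 < c) (hc : c < 1 / 2) :
    ∃ a : ℝ, 0 < a ∧ ∃ D₀ : ℕ, ∀ d : ℕ, D₀ ≤ d →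
      2 * K + 4 ≤ d ∧ 0 < 1 / 2 - c * Real.sqrt (Real.log d / d) ∧
      a * (d : ℝ) ^ (-(2 * c ^ 2) : ℝ) / Real.sqrt (Real.log d) ≤
        ∑ k ∈ Finset.range (2 * (d / 2 - K) + 1),
          (((2 * (d / 2 - K)).choose k : ℝ) * (1 / 2 - c * Real.sqrt (Real.log d / d)) ^ k *
            (1 - (1 / 2 - c * Real.sqrt (Real.log d / d))) ^ (2 * (d / 2 - K) - k) *
            if d / 2 - K + C ≤ k then 1 else 0) := by
  refine ⟨Real.exp (-(8 + 8 * (C + 1))) / 4, by positivity, ?_⟩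
  have hlog : Tendsto (fun d : ℕ => Real.log (d : ℝ)) atTop atTop :=
    Real.tendsto_log_atTop.comp tendsto_natCast_atTop_atTop
  have ev1 := hlog.eventually_ge_atTop 64
  have ev2 : ∀ᶠ d : ℕ in atTop, Real.log d ^ 2 ≤ d := by
    have h := (Real.isLittleO_pow_log_id_atTop (n := 2)).bound (c := 1) one_pos
    have h := tendsto_natCast_atTop_atTop (R := ℝ) |>.eventually h
    filter_upwards [h] with d hd
    simpa using hd
  have ev3 := eventually_ge_atTop (4 * (4 * C ^ 2 + K + 1) + 2 * K + 4)
  obtain ⟨D₀, hD⟩ := eventually_atTop.mp ((ev1.and ev2).and ev3)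
  refine ⟨D₀, fun d hd => ?_⟩
  obtain ⟨⟨hL, hL2⟩, h3⟩ := hD d hd
  have h3' : 4 * (4 * (C : ℝ) ^ 2 + K + 1) + 2 * K + 4 ≤ d := by exact_mod_cast h3
  have hKn : (0 : ℝ) ≤ K := Nat.cast_nonneg K
  have hCn : (0 : ℝ) ≤ C := Nat.cast_nonneg C
  have hd0 : (0 : ℝ) < d := by nlinarith [sq_nonneg (C : ℝ)]
  set p := 1 / 2 - c * Real.sqrt (Real.log d / d) with hp
  have hrle : Real.sqrt (Real.log d / d) ≤ 1 / 8 := by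
    apply Real.sqrt_le_iff.mpr ⟨by norm_num, ?_⟩
    rw [div_le_iff₀ hd0]
    nlinarith
  have hr0 := Real.sqrt_nonneg (Real.log d / d)
  have hp0 : 0 < p := by nlinarith
  have hq0 : 0 < 1 - p := by
    have : 0 ≤ c * Real.sqrt (Real.log d / d) := by positivity
    linarith
  refine ⟨by omega, hp0, ?_⟩
  set M := d / 2 - K with hM
  set R := Real.sqrt (d / Real.log d) with hR
  have hR2 : R ^ 2 = d / Real.log d := Real.sq_sqrt (by positivity)
  have hMr : (d : ℝ) / 2 - K - 1 ≤ M := by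
    have : d ≤ 2 * M + 2 * K + 2 := by omega
    have : (d : ℝ) ≤ 2 * M + 2 * K + 2 := by exact_mod_cast this
    linarith
  have hCR : 2 * (C + R) ^ 2 ≤ M := by
    have : R ^ 2 ≤ d / 16 := by
      rw [hR2]; gcongr; linarith
    nlinarith [sq_nonneg ((C : ℝ) - R)]
  have hterm : ∀ j ∈ Finset.range ⌈R⌉₊,
      Real.exp (-(8 + 8 * (C + 1))) / (4 * Real.sqrt d) * (d : ℝ) ^ (-(2 * c ^ 2) : ℝ) ≤
      ((2 * M).choose (M + (C + j)) : ℝ) * p ^ (M + (C + j)) * (1 - p) ^ (2 * M - (M + (C + j))) := by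
    intro j hj
    have hj : (j : ℝ) < R := Nat.lt_ceil.mp (Finset.mem_range.mp hj)
    apply term_lower M (C + j) d C c hc0 hc hL hL2 (by omega) (by omega)
    · push_cast; linarith
    · push_cast
      refine le_trans ?_ hCR
      gcongr
  have hMle : ∀ j ∈ Finset.range ⌈R⌉₊, M + (C + j) < 2 * M + 1 := by
    intro j hj
    have hj : (j : ℝ) < R := Nat.lt_ceil.mp (Finset.mem_range.mp hj)
    have h1 : 2 * ((C : ℝ) + j) ^ 2 ≤ M := le_trans (by gcongr) hCR
    have h1 : 2 * (C + j) ^ 2 ≤ M := by exact_mod_cast h1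
    nlinarith
  calc Real.exp (-(8 + 8 * (C + 1))) / 4 * (d : ℝ) ^ (-(2 * c ^ 2) : ℝ) / Real.sqrt (Real.log d)
      = R * (Real.exp (-(8 + 8 * (C + 1))) / (4 * Real.sqrt d) * (d : ℝ) ^ (-(2 * c ^ 2) : ℝ)) := by
        rw [hR, Real.sqrt_div hd0.le]
        have : 0 < Real.sqrt d := Real.sqrt_pos.mpr hd0
        field_simp
    _ ≤ (⌈R⌉₊ : ℝ) * (Real.exp (-(8 + 8 * (C + 1))) / (4 * Real.sqrt d) * (d : ℝ) ^ (-(2 * c ^ 2) : ℝ)) := by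
        gcongr
        exact Nat.le_ceil R
    _ = ∑ j ∈ Finset.range ⌈R⌉₊, (Real.exp (-(8 + 8 * (C + 1))) / (4 * Real.sqrt d) * (d : ℝ) ^ (-(2 * c ^ 2) : ℝ)) := by
        rw [Finset.sum_const, Finset.card_range, nsmul_eq_mul]
    _ ≤ ∑ j ∈ Finset.range ⌈R⌉₊, (((2 * M).choose (M + (C + j)) : ℝ) * p ^ (M + (C + j)) *
          (1 - p) ^ (2 * M - (M + (C + j))) * if M + C ≤ (M + (C + j)) then 1 else 0) := by
        apply Finset.sum_le_sum
        intro j hj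
        rw [if_pos (by omega), mul_one]
        exact hterm j hj
    _ = ∑ k ∈ (Finset.range ⌈R⌉₊).image (fun j => M + (C + j)), (((2 * M).choose k : ℝ) * p ^ k *
          (1 - p) ^ (2 * M - k) * if M + C ≤ k then 1 else 0) := by
        rw [Finset.sum_image]
        intro i _ j _ h
        simp only at h
        omega
    _ ≤ _ := by
        apply Finset.sum_le_sum_of_subset_of_nonneg
        · intro k hk
          obtain ⟨j, hj, rfl⟩ := Finset.mem_image.mp hk
          exact Finset.mem_range.mpr (hMle j hj)
        · intro k _ _
          split_ifs <;> positivity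

section prob
open Classical

lemma weight_coe {V : Type} [Fintype V] (p : ℝ) (A : Finset V) :
    weight p (A : Set V) = p ^ A.card * (1 - p) ^ (Fintype.card V - A.card) := by
  unfold weight
  rw [Set.ncard_coe_finset, ← Finset.coe_compl, Set.ncard_coe_finset, Finset.card_compl]

lemma expOn_eq {V : Type} [Fintype V] (p : ℝ) (E : Set V → Prop) (f : Set V → ℝ) :
    expOn p E f = ∑ A : Finset V, if E A then weight p (A : Set V) * f A else 0 := by
  unfold expOn
  rw [finsum_mem_eq_finite_toFinset_sum _ (Set.toFinite _)]
  rw [← Finset.sum_filter]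
  symm
  apply Finset.sum_bij (fun (A : Finset V) _ => (A : Set V))
  · intro A hA; simpa using hA
  · intro A _ B _ h; exact Finset.coe_injective h
  · intro S hS
    refine ⟨S.toFinset, ?_, by simp⟩
    simpa using hS
  · intro A _; rfl

lemma prob_eq_expOn {V : Type} (p : ℝ) (E : Set V → Prop) :
    prob p E = expOn p E (fun _ => 1) := by
  unfold prob expOn; simp

lemma sum_split {V : Type} [Fintype V] (W : Finset V) (φ : Finset V → Finset V → ℝ) :
    ∑ A : Finset V, φ (A ∩ W) (A \ W) = ∑ B ∈ W.powerset, ∑ C ∈ Wᶜ.powerset, φ B C := by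
  rw [← Finset.sum_product']
  apply Finset.sum_bij' (fun A _ => (A ∩ W, A \ W)) (fun (q : Finset V × Finset V) _ => q.1 ∪ q.2)
  · intro A _
    simp only [Finset.mem_product, Finset.mem_powerset]
    refine ⟨Finset.inter_subset_right, ?_⟩
    intro v hv
    simp at hv ⊢; exact hv.2
  · intro _ _; simp
  · intro A _
    ext v; simp; tauto
  · rintro ⟨B, C⟩ h
    simp only [Finset.mem_product, Finset.mem_powerset] at h
    obtain ⟨h1, h2⟩ := h
    have h3 : ∀ v ∈ C, v ∉ W := fun v hv => by simpa using h2 hv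
    ext v
    · simp
      constructor
      · rintro ⟨a | a, b⟩
        · exact a
        · exact absurd b (h3 v a)
      · intro a; exact ⟨Or.inl a, h1 a⟩
    · simp
      constructor
      · rintro ⟨a | a, b⟩
        · exact absurd (h1 a) b
        · exact a
      · intro a; exact ⟨Or.inr a, h3 v a⟩
  · intro _ _; rfl

lemma indep {V : Type} [Fintype V] (p : ℝ) (W : Finset V) (F : Finset V → ℝ) (h : ℕ → ℝ) :
    ∑ A : Finset V, weight p (A : Set V) * (F (A \ W) * h (A ∩ W).card)
      = (∑ A : Finset V, weight p (A : Set V) * F (A \ W)) *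
        ∑ k ∈ Finset.range (W.card + 1), ((W.card.choose k : ℝ) * p ^ k * (1 - p) ^ (W.card - k) * h k) := by
  have hw : ∀ A : Finset V, weight p (A : Set V) =
      (p ^ (A ∩ W).card * (1 - p) ^ (W.card - (A ∩ W).card)) *
      (p ^ (A \ W).card * (1 - p) ^ (Wᶜ.card - (A \ W).card)) := by
    intro A
    rw [weight_coe]
    have h1 : (A ∩ W).card + (A \ W).card = A.card := Finset.card_inter_add_card_sdiff A W
    have h2 : W.card + Wᶜ.card = Fintype.card V := Finset.card_add_card_compl W
    have h3 : (A ∩ W).card ≤ W.card := Finset.card_le_card Finset.inter_subset_right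
    have h4 : (A \ W).card ≤ Wᶜ.card := by
      apply Finset.card_le_card
      intro v hv
      simp at hv ⊢; exact hv.2
    have h5 : Fintype.card V - A.card = (W.card - (A ∩ W).card) + (Wᶜ.card - (A \ W).card) := by omega
    rw [h5, ← h1, pow_add, pow_add]; ring
  have gen : ∀ g : ℕ → ℝ, ∑ A : Finset V, weight p (A : Set V) * (F (A \ W) * g (A ∩ W).card)
      = (∑ k ∈ Finset.range (W.card + 1), ((W.card.choose k : ℝ) * p ^ k * (1 - p) ^ (W.card - k) * g k)) *
        ∑ C ∈ Wᶜ.powerset, (p ^ C.card * (1 - p) ^ (Wᶜ.card - C.card)) * F C := by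
    intro g
    simp_rw [hw]
    rw [sum_split W (fun B C => (p ^ B.card * (1 - p) ^ (W.card - B.card)) *
      (p ^ C.card * (1 - p) ^ (Wᶜ.card - C.card)) * (F C * g B.card))]
    have := Finset.sum_powerset_apply_card (fun k => p ^ k * (1 - p) ^ (W.card - k) * g k) (x := W)
    have e : (∑ k ∈ Finset.range (W.card + 1), ((W.card.choose k : ℝ) * p ^ k * (1 - p) ^ (W.card - k) * g k))
      = ∑ B ∈ W.powerset, p ^ B.card * (1 - p) ^ (W.card - B.card) * g B.card := by
      rw [this]
      apply Finset.sum_congr rfl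
      intro k _
      rw [nsmul_eq_mul]; ring
    rw [e, Finset.sum_mul_sum]
    apply Finset.sum_congr rfl; intro B _
    apply Finset.sum_congr rfl; intro C _
    ring
  have one : ∑ k ∈ Finset.range (W.card + 1), ((W.card.choose k : ℝ) * p ^ k * (1 - p) ^ (W.card - k) * 1) = 1 := by
    have := add_pow p (1 - p) W.card
    rw [show p + (1 - p) = 1 by ring, one_pow] at this
    refine Eq.trans ?_ this.symm
    apply Finset.sum_congr rfl; intro k _; ring
  have g1 := gen (fun _ => 1)
  simp only [one, one_mul] at g1
  simp only [mul_one] at g1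
  rw [gen h, g1, mul_comm]

lemma toggle {V : Type} [Fintype V] (p : ℝ) (hp0 : 0 < p) (hp : p ≤ 1 / 2) (N : Finset V) (x y : V)
    (hy : y ∈ N) (hxy : y ≠ x) (T : ℕ) :
    ∑ A : Finset V, (if x ∉ A ∧ y ∈ A ∧ T + 1 ≤ (N ∩ A).card then weight p (A : Set V) else 0)
    ≤ ∑ A : Finset V, (if (x ∉ A ∧ T ≤ (N ∩ A).card) ∧ y ∉ A then weight p (A : Set V) else 0) := by
  rw [← Finset.sum_filter, ← Finset.sum_filter]
  have hw : ∀ A : Finset V, 0 ≤ weight p (A : Set V) := by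
    intro A; rw [weight_coe]
    have : 0 ≤ 1 - p := by linarith
    positivity
  have h1 : ∀ A : Finset V, y ∈ A → weight p (A : Set V) ≤ weight p ((A.erase y : Finset V) : Set V) := by
    intro A hA
    rw [weight_coe, weight_coe, Finset.card_erase_of_mem hA]
    have c1 : 1 ≤ A.card := Finset.card_pos.mpr ⟨y, hA⟩
    have c2 : A.card ≤ Fintype.card V := Finset.card_le_univ A
    obtain ⟨k, hk⟩ := Nat.exists_eq_add_of_le c1
    have e : Fintype.card V - (A.card - 1) = (Fintype.card V - A.card) + 1 := by omega
    rw [e, hk, Nat.add_sub_cancel_left, pow_add, pow_one, pow_succ]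
    have : 0 ≤ 1 - p := by linarith
    have : 0 ≤ p ^ k * (1 - p) ^ (Fintype.card V - (1 + k)) := by positivity
    nlinarith
  calc _ ≤ ∑ A ∈ Finset.univ.filter (fun A : Finset V => x ∉ A ∧ y ∈ A ∧ T + 1 ≤ (N ∩ A).card),
            weight p ((A.erase y : Finset V) : Set V) := by
        apply Finset.sum_le_sum
        intro A hA
        exact h1 A (Finset.mem_filter.mp hA).2.2.1
    _ = ∑ B ∈ (Finset.univ.filter (fun A : Finset V => x ∉ A ∧ y ∈ A ∧ T + 1 ≤ (N ∩ A).card)).image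
          (fun A : Finset V => (A.erase y : Finset V)), weight p ((B : Finset V) : Set V) := by
        rw [Finset.sum_image]
        intro A hA B hB h
        have hA' := (Finset.mem_filter.mp hA).2.2.1
        have hB' := (Finset.mem_filter.mp hB).2.2.1
        simp only at h
        rw [← Finset.insert_erase hA', h, Finset.insert_erase hB']
    _ ≤ _ := by
        apply Finset.sum_le_sum_of_subset_of_nonneg
        · intro B hB
          obtain ⟨A, hA, rfl⟩ := Finset.mem_image.mp hB
          obtain ⟨_, a1, a2, a3⟩ := Finset.mem_filter.mp hA
          simp only [Finset.mem_filter, Finset.mem_univ, true_and]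
          refine ⟨⟨fun h => a1 (Finset.mem_of_mem_erase h), ?_⟩, Finset.notMem_erase y A⟩
          rw [Finset.inter_erase, Finset.card_erase_of_mem (Finset.mem_inter.mpr ⟨hy, a2⟩)]
          omega
        · intro A _ _; exact hw A

lemma nonmem_sum {V : Type} [Fintype V] (p : ℝ) (hp0 : 0 < p) (hp : p ≤ 1 / 2) (N : Finset V) (x : V)
    (hx : x ∉ N) (T : ℕ) :
    ((N.card : ℝ) - T) / 2 *
      ∑ A : Finset V, (if x ∉ A ∧ T ≤ (N ∩ A).card then weight p (A : Set V) else 0)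
    ≤ ∑ y ∈ N, ∑ A : Finset V,
      (if (x ∉ A ∧ T ≤ (N ∩ A).card) ∧ y ∉ A then weight p (A : Set V) else 0) := by
  have hw : ∀ A : Finset V, 0 ≤ weight p (A : Set V) := by
    intro A; rw [weight_coe]
    have : 0 ≤ 1 - p := by linarith
    positivity
  have h1 := Finset.sum_le_sum (fun y (hy : y ∈ N) =>
    toggle p hp0 hp N x y hy (fun h => hx (h ▸ hy)) T)
  have e1 : ∑ y ∈ N, ∑ A : Finset V,
      (if (x ∉ A ∧ T ≤ (N ∩ A).card) ∧ y ∉ A then weight p (A : Set V) else 0)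
      = ∑ A : Finset V, (if x ∉ A ∧ T ≤ (N ∩ A).card then weight p (A : Set V) else 0) *
          ((N.card : ℝ) - (N ∩ A).card) := by
    rw [Finset.sum_comm]
    apply Finset.sum_congr rfl; intro A _
    by_cases hE : x ∉ A ∧ T ≤ (N ∩ A).card
    · rw [if_pos hE]
      simp only [and_iff_right hE]
      rw [← Finset.sum_filter, Finset.sum_const, nsmul_eq_mul, mul_comm]
      congr 1
      have : N.filter (fun y => y ∉ A) = N \ A := by ext v; simp
      rw [this]
      have := Finset.card_inter_add_card_sdiff N A
      rw [← this]; push_cast; ring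
    · simp [hE]
  have e2 : ∑ A : Finset V, (if x ∉ A ∧ T ≤ (N ∩ A).card then weight p (A : Set V) else 0) *
          (((N ∩ A).card : ℝ) - T) ≤
      ∑ y ∈ N, ∑ A : Finset V,
      (if x ∉ A ∧ y ∈ A ∧ T + 1 ≤ (N ∩ A).card then weight p (A : Set V) else 0) := by
    rw [Finset.sum_comm]
    apply Finset.sum_le_sum; intro A _
    have hnn : 0 ≤ ∑ y ∈ N, (if x ∉ A ∧ y ∈ A ∧ T + 1 ≤ (N ∩ A).card then weight p (A : Set V) else 0) := by
      apply Finset.sum_nonneg; intro y _; split_ifs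
      · exact hw A
      · exact le_rfl
    by_cases hE : x ∉ A ∧ T ≤ (N ∩ A).card
    · rw [if_pos hE]
      by_cases hT : T + 1 ≤ (N ∩ A).card
      · simp only [hE.1, hT, not_false_eq_true, true_and, and_true]
        rw [← Finset.sum_filter, Finset.sum_const, nsmul_eq_mul, mul_comm, Finset.filter_mem_eq_inter]
        have := hw A
        have hT0 : (0 : ℝ) ≤ T := Nat.cast_nonneg T
        gcongr
        linarith
      · have : (N ∩ A).card = T := by omega
        rw [show (((N ∩ A).card : ℝ) - T) = 0 by rw [this, sub_self], mul_zero]; exact hnn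
    · rw [if_neg hE, zero_mul]; exact hnn
  rw [e1] at h1 ⊢
  have e3 : ∑ A : Finset V, (if x ∉ A ∧ T ≤ (N ∩ A).card then weight p (A : Set V) else 0) *
          ((N.card : ℝ) - (N ∩ A).card) +
      ∑ A : Finset V, (if x ∉ A ∧ T ≤ (N ∩ A).card then weight p (A : Set V) else 0) *
          (((N ∩ A).card : ℝ) - T)
      = ((N.card : ℝ) - T) *
      ∑ A : Finset V, (if x ∉ A ∧ T ≤ (N ∩ A).card then weight p (A : Set V) else 0) := by
    rw [← Finset.sum_add_distrib, Finset.mul_sum]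
    apply Finset.sum_congr rfl; intro A _; ring
  linarith

/-- Abstract main estimate. -/
lemma main_prob {V : Type} [Fintype V] (p : ℝ) (hp0 : 0 < p) (hp : p ≤ 1 / 2) (N : Finset V) (x : V)
    (hx : x ∉ N) (T R n : ℕ) (W : V → Finset V) (hWx : ∀ y ∈ N, x ∉ W y)
    (hWN : ∀ y ∈ N, Disjoint (W y) N) (hWc : ∀ y ∈ N, (W y).card = n) (hT : T ≤ N.card)
    (E : Set V → Prop) (hE : ∀ A : Finset V, E A ↔ (x ∉ A ∧ T ≤ (N ∩ A).card))
    (f : Set V → ℝ)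
    (hf : ∀ A : Finset V, x ∉ A → ∑ y ∈ N, (if y ∉ A ∧ R ≤ (A ∩ W y).card then (1 : ℝ) else 0) ≤ f A) :
    ((N.card : ℝ) - T) / 2 *
      (∑ k ∈ Finset.range (n + 1), ((n.choose k : ℝ) * p ^ k * (1 - p) ^ (n - k) * if R ≤ k then 1 else 0))
      ≤ condExp p E f := by
  have hw : ∀ A : Finset V, 0 < weight p (A : Set V) := by
    intro A; rw [weight_coe]
    have : 0 < 1 - p := by linarith
    positivity
  set β := ∑ k ∈ Finset.range (n + 1),
    ((n.choose k : ℝ) * p ^ k * (1 - p) ^ (n - k) * if R ≤ k then (1 : ℝ) else 0) with hβ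
  have hβ0 : 0 ≤ β := by
    apply Finset.sum_nonneg; intro k _
    have : 0 < 1 - p := by linarith
    split_ifs <;> positivity
  unfold condExp
  rw [prob_eq_expOn, expOn_eq, expOn_eq]
  simp only [hE, mul_one]
  have hS : 0 < ∑ A : Finset V, (if x ∉ A ∧ T ≤ (N ∩ A).card then weight p (A : Set V) else 0) := by
    apply Finset.sum_pos'
    · intro A _; split_ifs
      · exact (hw A).le
      · exact le_rfl
    · refine ⟨N, Finset.mem_univ _, ?_⟩
      rw [if_pos ⟨hx, by simpa using hT⟩]; exact hw N
  rw [le_div_iff₀ hS]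
  have hns := nonmem_sum p hp0 hp N x hx T
  have hind : ∀ y ∈ N, ∑ A : Finset V,
      (if (x ∉ A ∧ T ≤ (N ∩ A).card) ∧ y ∉ A then weight p (A : Set V) else 0) *
        (if R ≤ (A ∩ W y).card then 1 else 0)
      = (∑ A : Finset V,
      (if (x ∉ A ∧ T ≤ (N ∩ A).card) ∧ y ∉ A then weight p (A : Set V) else 0)) * β := by
    intro y hy
    have hinv : ∀ A : Finset V, ((x ∉ A \ W y ∧ T ≤ (N ∩ (A \ W y)).card) ∧ y ∉ A \ W y) ↔
        ((x ∉ A ∧ T ≤ (N ∩ A).card) ∧ y ∉ A) := by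
      intro A
      have hd := Finset.disjoint_left.mp (hWN y hy)
      have i1 : N ∩ (A \ W y) = N ∩ A := by
        ext v; simp only [Finset.mem_inter, Finset.mem_sdiff]
        constructor
        · rintro ⟨a, b, _⟩; exact ⟨a, b⟩
        · rintro ⟨a, b⟩; exact ⟨a, b, fun h => hd h a⟩
      have i2 : y ∉ W y := fun h => hd h hy
      rw [i1]
      simp [hWx y hy, i2]
    have := indep p (W y) (fun A => if (x ∉ A ∧ T ≤ (N ∩ A).card) ∧ y ∉ A then 1 else 0)
      (fun k => if R ≤ k then 1 else 0)
    simp only [hinv] at this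
    rw [hWc y hy] at this
    rw [hβ]
    simp only [← mul_assoc, mul_ite, mul_one, mul_zero] at this ⊢
    convert this using 0
  calc _ = (((N.card : ℝ) - T) / 2 *
      ∑ A : Finset V, (if x ∉ A ∧ T ≤ (N ∩ A).card then weight p (A : Set V) else 0)) * β := by ring
    _ ≤ (∑ y ∈ N, ∑ A : Finset V,
      (if (x ∉ A ∧ T ≤ (N ∩ A).card) ∧ y ∉ A then weight p (A : Set V) else 0)) * β := by gcongr
    _ = ∑ y ∈ N, ∑ A : Finset V,
      (if (x ∉ A ∧ T ≤ (N ∩ A).card) ∧ y ∉ A then weight p (A : Set V) else 0) *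
        (if R ≤ (A ∩ W y).card then 1 else 0) := by
        rw [Finset.sum_mul]
        exact Finset.sum_congr rfl (fun y hy => (hind y hy).symm)
    _ ≤ _ := by
        rw [Finset.sum_comm]
        apply Finset.sum_le_sum; intro A _
        by_cases hEA : x ∉ A ∧ T ≤ (N ∩ A).card
        · rw [if_pos hEA]
          refine le_trans (le_of_eq ?_) (mul_le_mul_of_nonneg_left (hf A hEA.1) (hw A).le)
          rw [Finset.mul_sum]
          apply Finset.sum_congr rfl; intro y _
          by_cases h1 : y ∈ A <;> by_cases h2 : R ≤ (A ∩ W y).card <;> simp [h1, h2, hEA]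
        · simp [hEA]

end prob

/-- conditional expectation of the number of neighbours infected in round one. -/
theorem statement10 (K m : ℕ) (c : ℝ) (hc0 : 0 < c) (hc : c < 1 / 2) :
    ∃ a : ℝ, 0 < a ∧ ∃ D₀ : ℕ, ∀ (V : Type) [Finite V], ∀ G : SimpleGraph V,
      InH K G → D₀ ≤ minDeg G → ∀ x : V, ∀ ℓ : ℕ,
      m ≤ ℓ → (ℓ : ℝ) ≤ (deg G x : ℝ) / 2 + m →
      a * (deg G x : ℝ) ^ (1 - 2 * c ^ 2 : ℝ) / Real.sqrt (Real.log (deg G x))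
        ≤ condExp (1 / 2 - c * Real.sqrt (Real.log (deg G x) / (deg G x)))
            (fun A0 => x ∉ A0 ∧
              (deg G x : ℝ) / 2 + m - ℓ ≤ ((G.neighborSet x ∩ A0).ncard : ℝ))
            (fun A0 => ((G.neighborSet x ∩ (bootIterM G m A0 1 \ A0)).ncard : ℝ)) := by
  classical
  obtain ⟨a, ha, D₁, htail⟩ := tail_lower K (2 * K + m + 1) c hc0 hc
  refine ⟨a / 16, by positivity, D₁ + 8, ?_⟩
  intro V _ G hG hD x ℓ hmℓ _
  have := Fintype.ofFinite V
  have hdx : D₁ + 8 ≤ deg G x := hD.trans (Nat.sInf_le ⟨x, rfl⟩)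
  obtain ⟨hP1, hP2⟩ : P1 K G ∧ P2 K G := by
    have hcard : Nat.card V ≠ 1 := by
      intro h
      have hsub := (Nat.card_eq_one_iff_unique.mp h).1
      have : G.neighborSet x = ∅ := by
        ext y
        simp only [SimpleGraph.mem_neighborSet, Set.mem_empty_iff_false, iff_false]
        intro hadj
        exact hadj.ne (Subsingleton.elim x y)
      have : deg G x = 0 := by unfold deg; rw [this]; simp
      omega
    obtain ⟨n, hn⟩ := hG
    cases n with
    | zero => exact absurd hn hcard
    | succ n =>
      rcases hn with h | h
      · exact absurd h hcard
      · exact ⟨h.1, h.2.1⟩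
  obtain ⟨hK, hp0, ht⟩ := htail (deg G x) (by omega)
  set d := deg G x with hd
  set p := 1 / 2 - c * Real.sqrt (Real.log d / d) with hp
  have hp2 : p ≤ 1 / 2 := by
    have : 0 ≤ c * Real.sqrt (Real.log d / d) := by positivity
    linarith
  set M := d / 2 - K with hM
  set N : Finset V := (G.neighborSet x).toFinset with hN
  have hNc : N.card = d := by rw [hd, deg, hN, Set.ncard_eq_toFinset_card']
  have hmemN : ∀ y, y ∈ N ↔ G.Adj x y := by intro y; simp [hN]
  have hW : ∀ y ∈ N, ∃ W : Finset V, W.card = 2 * M ∧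
      ∀ v ∈ W, G.Adj y v ∧ v ≠ x ∧ v ∉ N := by
    intro y hy
    have hadj := (hmemN y).mp hy
    have hsph : y ∈ sphere G x 1 := by
      simp only [sphere, Set.mem_ofPred_eq, Nat.cast_one]
      exact SimpleGraph.edist_eq_one_iff_adj.mpr hadj
    have h1 := hP1 x 1 le_rfl y hsph
    have h2 := hP2 x 1 le_rfl y hsph
    have h3 := Set.ncard_inter_add_ncard_sdiff_eq_ncard (G.neighborSet y) (ball G x 1) (Set.toFinite _)
    have h4 : (G.neighborSet y).ncard = deg G y := rfl
    rw [abs_le] at h1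
    have h5 : 2 * M ≤ (G.neighborSet y \ ball G x 1).toFinset.card := by
      rw [← Set.ncard_eq_toFinset_card']
      push_cast at h1
      omega
    obtain ⟨W, hWs, hWc⟩ := Finset.exists_subset_card_eq h5
    refine ⟨W, hWc, fun v hv => ?_⟩
    have hv : G.Adj y v ∧ ¬ (G.edist x v ≤ ((1 : ℕ) : ℕ∞)) := by
      have h6 : v ∈ G.neighborSet y \ ball G x 1 := Set.mem_toFinset.mp (hWs hv)
      exact ⟨h6.1, h6.2⟩
    refine ⟨hv.1, ?_, ?_⟩
    · rintro rfl
      apply hv.2; simp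
    · intro hvN
      apply hv.2
      rw [SimpleGraph.edist_eq_one_iff_adj.mpr ((hmemN v).mp hvN)]; simp
  choose! W hWc hWp using hW
  set t : ℝ := (d : ℝ) / 2 + m - ℓ with htdef
  have htd : t ≤ d / 2 := by
    have : (m : ℝ) ≤ ℓ := by exact_mod_cast hmℓ
    linarith
  have hT1 : ⌈t⌉₊ ≤ (d + 1) / 2 := by
    apply Nat.ceil_le.mpr
    have h : d ≤ 2 * ((d + 1) / 2) := by omega
    have h : (d : ℝ) ≤ 2 * (((d + 1) / 2 : ℕ) : ℝ) := by exact_mod_cast h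
    linarith
  have hmain := main_prob p hp0 hp2 N x (by simp [hN]) ⌈t⌉₊ (M + (2 * K + m + 1)) (2 * M) W
    (fun y hy h => (hWp y hy x h).2.1 rfl)
    (fun y hy => Finset.disjoint_left.mpr (fun v hv => (hWp y hy v hv).2.2))
    hWc (by omega)
    (fun A0 => x ∉ A0 ∧ t ≤ ((G.neighborSet x ∩ A0).ncard : ℝ))
    (by
      intro A
      have : G.neighborSet x ∩ (A : Set V) = ((N ∩ A : Finset V) : Set V) := by
        rw [Finset.coe_inter, hN, Set.coe_toFinset]
      simp only [this, Set.ncard_coe_finset, Nat.ceil_le, Finset.mem_coe])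
    (fun A0 => ((G.neighborSet x ∩ (bootIterM G m A0 1 \ A0)).ncard : ℝ))
    (by
      intro A _
      rw [← Finset.sum_filter, Finset.sum_const, nsmul_eq_mul, mul_one, ← Set.ncard_coe_finset]
      have : ((N.filter (fun y => y ∉ A ∧ M + (2 * K + m + 1) ≤ (A ∩ W y).card) : Finset V) : Set V)
          ⊆ G.neighborSet x ∩ (bootIterM G m A 1 \ A) := by
        intro y hy
        simp only [Finset.coe_filter, Set.mem_ofPred_eq] at hy
        obtain ⟨hyN, hyA, hyR⟩ := hy
        have hadj := (hmemN y).mp hyN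
        refine ⟨hadj, Or.inr ?_, by simpa using hyA⟩
        have hsph : y ∈ sphere G x 1 := by
          simp only [sphere, Set.mem_ofPred_eq, Nat.cast_one]
          exact SimpleGraph.edist_eq_one_iff_adj.mpr hadj
        have h1 := hP1 x 1 le_rfl y hsph
        rw [abs_le] at h1
        have h2 : (A ∩ W y).card ≤ (G.neighborSet y ∩ bootIterM G m (A : Set V) 0).ncard := by
          rw [← Set.ncard_coe_finset]
          apply Set.ncard_le_ncard _ (Set.toFinite _)
          intro v hv
          have hv : v ∈ A ∧ v ∈ W y := by simpa using hv
          exact ⟨(hWp y hyN v hv.2).1, hv.1⟩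
        have h3 : deg G y + 2 * m ≤ 2 * (G.neighborSet y ∩ bootIterM G m (A : Set V) 0).ncard := by
          push_cast at h1
          omega
        have h3 : (deg G y : ℝ) + 2 * m ≤ 2 * ((G.neighborSet y ∩ bootIterM G m (A : Set V) 0).ncard : ℝ) := by
          exact_mod_cast h3
        simp only [Set.mem_ofPred_eq]
        linarith
      exact_mod_cast Set.ncard_le_ncard this (Set.toFinite _))
  refine le_trans ?_ hmain
  rw [hNc]
  have hd0 : (0 : ℝ) < d := by
    have : 0 < d := by omega
    exact_mod_cast this
  have hT2 : (d : ℝ) / 8 ≤ ((d : ℝ) - (⌈t⌉₊ : ℝ)) / 2 := by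
    have : 4 * ⌈t⌉₊ ≤ 3 * d := by omega
    have : 4 * (⌈t⌉₊ : ℝ) ≤ 3 * d := by exact_mod_cast this
    linarith
  calc a / 16 * (d : ℝ) ^ (1 - 2 * c ^ 2 : ℝ) / Real.sqrt (Real.log d)
      = d / 16 * (a * (d : ℝ) ^ (-(2 * c ^ 2) : ℝ) / Real.sqrt (Real.log d)) := by
        rw [sub_eq_add_neg, Real.rpow_add hd0, Real.rpow_one]; ring
    _ ≤ d / 8 * (a * (d : ℝ) ^ (-(2 * c ^ 2) : ℝ) / Real.sqrt (Real.log d)) := by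
        gcongr
        norm_num
    _ ≤ _ := by
        refine mul_le_mul hT2 ht (by positivity) (le_trans (by positivity) hT2)

end MBP
end
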